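/- arXiv:2501.10341 — 3 statements merged into one kernel-verified Lean document; each statement's English description precedes it below -/
import Mathlib

section
/- Let N ≥ 2, let 𝒩 be a norm on ℝ^N and α ∈ (0,2). Then the 1-homogeneous function Φ_α : ℝ^N → [0,∞), defined by Φ_α(0) = 0 and Φ_α(p) = |p| · ( 2 ∫_{p^⊥} (1 + 𝒩(x)^{N+α})^{−1} dH^{N−1}(x) )^{−1} for p ≠ 0, is convex on ℝ^N. -/
open MeasureTheory Metric Set Filter
open scoped RealInnerProductSpace Classical Topology

noncomputable section

/-- `𝒩` is a norm on `ℝ^N`: positive definite, absolutely homogeneous and subadditive. -/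
def IsNorm {N : ℕ} (𝒩 : EuclideanSpace ℝ (Fin N) → ℝ) : Prop :=
  (∀ x, 0 ≤ 𝒩 x) ∧ (∀ x, 𝒩 x = 0 ↔ x = 0) ∧
  (∀ (c : ℝ) (x), 𝒩 (c • x) = |c| * 𝒩 x) ∧
  (∀ x y, 𝒩 (x + y) ≤ 𝒩 x + 𝒩 y)

open scoped ENNReal

/-- The one-dimensional Brunn–Minkowski inequality. -/
theorem volume_add_volume_le {A B C : Set ℝ} (hA : MeasurableSet A) (hB : MeasurableSet B)
    (hA' : A.Nonempty) (hB' : B.Nonempty) (hC : ∀ x ∈ A, ∀ y ∈ B, x + y ∈ C) :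
    volume A + volume B ≤ volume C := by
  have key : ∀ K ⊆ A, IsCompact K → K.Nonempty → ∀ L ⊆ B, IsCompact L → L.Nonempty →
      volume K + volume L ≤ volume C := by
    intro K hKA hK hKn L hLB hL hLn
    obtain ⟨a, ha, hamax⟩ := hK.exists_isGreatest hKn
    obtain ⟨b, hb, hbmin⟩ := hL.exists_isLeast hLn
    have h1 : volume ((fun x => x + b) '' K) = volume K := by
      simp [Set.image_add_right]
    have h2 : volume ((fun x => a + x) '' L) = volume L := by
      simp [Set.image_add_left]
    have hdisj : volume (((fun x => x + b) '' K) ∩ ((fun x => a + x) '' L)) = 0 := by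
      refine measure_mono_null (t := {a + b}) ?_ (by simp)
      rintro _ ⟨⟨x, hx, rfl⟩, ⟨y, hy, hxy⟩⟩
      have e1 := hamax hx
      have e2 := hbmin hy
      simp only at hxy
      simp only [mem_singleton_iff]
      linarith
    rw [← h1, ← h2, ← measure_union_add_inter₀ (μ := volume) _
      (hL.image (by fun_prop)).measurableSet.nullMeasurableSet, hdisj, add_zero]
    refine measure_mono ?_
    rintro _ (⟨x, hx, rfl⟩ | ⟨y, hy, rfl⟩)
    · exact hC _ (hKA hx) _ (hLB hb)
    · exact hC _ (hKA ha) _ (hLB hy)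
  obtain ⟨a₀, ha₀⟩ := hA'
  obtain ⟨b₀, hb₀⟩ := hB'
  have key' : ∀ K ⊆ A, IsCompact K → ∀ L ⊆ B, IsCompact L →
      volume K + volume L ≤ volume C := by
    intro K hKA hK L hLB hL
    calc volume K + volume L ≤ volume (insert a₀ K) + volume (insert b₀ L) := by
          gcongr <;> exact subset_insert _ _
      _ ≤ _ := key _ (insert_subset ha₀ hKA) (hK.insert _) (insert_nonempty _ _) _
          (insert_subset hb₀ hLB) (hL.insert _) (insert_nonempty _ _)
  rw [hA.measure_eq_iSup_isCompact, hB.measure_eq_iSup_isCompact]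
  refine ENNReal.biSup_add_biSup_le' (p := fun K => K ⊆ A) (q := fun K => K ⊆ B)
    ⟨∅, empty_subset _⟩ ⟨∅, empty_subset _⟩ ?_
  intro K hKA L hLB
  by_cases hK : IsCompact K <;> by_cases hL : IsCompact L
  · simpa [hK, hL] using key' K hKA hK L hLB hL
  · simpa [hK, hL] using key' K hKA hK ∅ (empty_subset _) isCompact_empty
  · simpa [hK, hL] using key' ∅ (empty_subset _) isCompact_empty L hLB hL
  · simp [hK, hL]

theorem lintegral_eq_lintegral_meas_lt_of_le_one {f : ℝ → ℝ≥0∞} (hf : Measurable f)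
    (h1 : ∀ x, f x ≤ 1) :
    ∫⁻ x, f x = ∫⁻ t in Ioi (0 : ℝ), volume {x | ENNReal.ofReal t < f x} := by
  have hne : ∀ x, f x ≠ ∞ := fun x => ((h1 x).trans_lt ENNReal.one_lt_top).ne
  have := lintegral_eq_lintegral_meas_lt (μ := (volume : Measure ℝ)) (f := fun x => (f x).toReal)
    (Eventually.of_forall fun x => ENNReal.toReal_nonneg) hf.ennreal_toReal.aemeasurable
  simp only [ENNReal.ofReal_toReal (hne _)] at this
  rw [this]
  refine setLIntegral_congr_fun measurableSet_Ioi fun t ht => ?_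
  simp only [ENNReal.ofReal_lt_iff_lt_toReal (le_of_lt ht) (hne _)]

theorem lintegral_add_lintegral_le_of_min_le {f g h : ℝ → ℝ≥0∞} (hf : Measurable f)
    (hg : Measurable g) (hh : Measurable h) (hf1 : ⨆ x, f x = 1) (hg1 : ⨆ x, g x = 1)
    (hfgh : ∀ x y, min (f x) (g y) ≤ h (x + y)) :
    (∫⁻ x, f x) + (∫⁻ x, g x) ≤ ∫⁻ x, h x := by
  have hf1' : ∀ x, f x ≤ 1 := fun x => hf1 ▸ le_iSup f x
  have hg1' : ∀ x, g x ≤ 1 := fun x => hg1 ▸ le_iSup g x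
  have hle : ∫⁻ x, min (h x) 1 ≤ ∫⁻ x, h x := lintegral_mono fun x => min_le_left _ _
  refine le_trans ?_ hle
  rw [lintegral_eq_lintegral_meas_lt_of_le_one hf hf1',
    lintegral_eq_lintegral_meas_lt_of_le_one hg hg1',
    lintegral_eq_lintegral_meas_lt_of_le_one (hh.min measurable_const) fun x => min_le_right _ _,
    ← lintegral_add_left']
  · refine lintegral_mono fun t => ?_
    by_cases ht : ENNReal.ofReal t < 1
    · refine volume_add_volume_le (measurableSet_lt measurable_const hf)
        (measurableSet_lt measurable_const hg) ?_ ?_ ?_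
      · exact lt_iSup_iff.1 (hf1 ▸ ht)
      · exact lt_iSup_iff.1 (hg1 ▸ ht)
      · intro x hx y hy
        exact lt_min ((lt_min hx hy).trans_le (hfgh x y)) ht
    · have e1 : {x | ENNReal.ofReal t < f x} = ∅ :=
        eq_empty_of_forall_notMem fun x hx => ht (lt_of_lt_of_le hx (hf1' x))
      have e2 : {x | ENNReal.ofReal t < g x} = ∅ :=
        eq_empty_of_forall_notMem fun x hx => ht (lt_of_lt_of_le hx (hg1' x))
      simp [e1, e2]
  · refine (Antitone.measurable fun s t hst => measure_mono fun x hx => ?_).aemeasurable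
    exact lt_of_le_of_lt (ENNReal.ofReal_le_ofReal hst) hx

/-- The power mean type combination `(u^{-1/k} + v^{-1/k})^{-k}` of two extended nonnegative
numbers. -/
def harmonicComb (k : ℝ) (u v : ℝ≥0∞) : ℝ≥0∞ := (u ^ (-k⁻¹) + v ^ (-k⁻¹)) ^ (-k)

theorem harmonicComb_mono {k : ℝ} (hk : 0 < k) {u v u' v' : ℝ≥0∞} (hu : u ≤ u') (hv : v ≤ v') :
    harmonicComb k u v ≤ harmonicComb k u' v' := by
  have hk' := inv_pos.2 hk
  unfold harmonicComb
  simp only [ENNReal.rpow_neg]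
  gcongr

theorem harmonicComb_zero_left {k : ℝ} (hk : 0 < k) (v : ℝ≥0∞) : harmonicComb k 0 v = 0 := by
  have hk' := inv_pos.2 hk
  simp [harmonicComb, ENNReal.zero_rpow_of_neg, ENNReal.top_rpow_of_neg, hk]

theorem harmonicComb_zero_right {k : ℝ} (hk : 0 < k) (v : ℝ≥0∞) : harmonicComb k v 0 = 0 := by
  have hk' := inv_pos.2 hk
  simp [harmonicComb, ENNReal.zero_rpow_of_neg, ENNReal.top_rpow_of_neg, hk]

theorem continuous_harmonicComb (k : ℝ) :
    Continuous fun p : ℝ≥0∞ × ℝ≥0∞ => harmonicComb k p.1 p.2 := by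
  unfold harmonicComb
  exact ENNReal.continuous_rpow_const.comp
    ((ENNReal.continuous_rpow_const.comp continuous_fst).add
      (ENNReal.continuous_rpow_const.comp continuous_snd))

theorem harmonicComb_mul {k : ℝ} (hk : 0 < k) {m : ℝ≥0∞} (hm : m ≠ ∞) (u v : ℝ≥0∞) :
    harmonicComb k (m * u) (m * v) = m * harmonicComb k u v := by
  rcases eq_or_ne m 0 with rfl | hm0
  · simp [harmonicComb_zero_left hk]
  have h0 : m ^ (-k⁻¹) ≠ 0 := by simp [hm, hm0]
  have h1 : m ^ (-k⁻¹) ≠ ∞ := by simp [hm, hm0]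
  unfold harmonicComb
  have e : ∀ w : ℝ≥0∞, (m * w) ^ (-k⁻¹) = m ^ (-k⁻¹) * w ^ (-k⁻¹) := fun w => by
    rcases eq_or_ne w ∞ with rfl | hw
    · rw [ENNReal.mul_top hm0, ENNReal.top_rpow_of_neg (by simpa using hk), mul_zero]
    · exact ENNReal.mul_rpow_of_ne_top hm hw _
  rw [e, e, ← mul_add]
  rcases eq_or_ne (u ^ (-k⁻¹) + v ^ (-k⁻¹)) ∞ with hw | hw
  · rw [hw, ENNReal.mul_top h0, ENNReal.top_rpow_of_neg (by simpa using hk), mul_zero]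
  · rw [ENNReal.mul_rpow_of_ne_top h1 hw, ← ENNReal.rpow_mul]
    have : -k⁻¹ * -k = 1 := by field_simp
    rw [this, ENNReal.rpow_one]

theorem harmonicComb_ofReal {k a b : ℝ} (ha : 0 < a) (hb : 0 < b) :
    harmonicComb k (ENNReal.ofReal a) (ENNReal.ofReal b) =
      ENNReal.ofReal ((a ^ (-k⁻¹) + b ^ (-k⁻¹)) ^ (-k)) := by
  unfold harmonicComb
  rw [ENNReal.ofReal_rpow_of_pos ha, ENNReal.ofReal_rpow_of_pos hb,
    ← ENNReal.ofReal_add (by positivity) (by positivity), ENNReal.ofReal_rpow_of_pos (by positivity)]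

/-- A two-term Hölder inequality. -/
theorem add_rpow_le_holder {k a b u v : ℝ} (hk : 0 < k) (ha : 0 < a) (hb : 0 < b) (hu : 0 < u)
    (hv : 0 < v) :
    (u + v) ^ (k + 1) ≤
      (a * u ^ (k + 1) + b * v ^ (k + 1)) * (a ^ (-k⁻¹) + b ^ (-k⁻¹)) ^ k := by
  have hpq : (k + 1).HolderConjugate ((k + 1) / k) := by
    rw [Real.holderConjugate_iff]
    constructor
    · linarith
    · field_simp
      ring
  have H := Real.inner_le_Lp_mul_Lq_of_nonneg (Finset.univ : Finset (Fin 2)) hpq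
    (f := ![a ^ (k + 1)⁻¹ * u, b ^ (k + 1)⁻¹ * v]) (g := ![a ^ (-(k + 1)⁻¹), b ^ (-(k + 1)⁻¹)])
    (by intro i _; fin_cases i <;> simp <;> positivity)
    (by intro i _; fin_cases i <;> simp <;> positivity)
  have hk1 : 0 < k + 1 := by linarith
  have e1 : ∀ c w : ℝ, 0 < c → 0 < w → c ^ (k + 1)⁻¹ * w * c ^ (-(k + 1)⁻¹) = w := by
    intro c w hc hw
    rw [Real.rpow_neg hc.le]
    field_simp
  have e2 : ∀ c w : ℝ, 0 < c → 0 < w → (c ^ (k + 1)⁻¹ * w) ^ (k + 1) = c * w ^ (k + 1) := by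
    intro c w hc hw
    rw [Real.mul_rpow (by positivity) hw.le, ← Real.rpow_mul hc.le, inv_mul_cancel₀ hk1.ne',
      Real.rpow_one]
  have e3 : ∀ c : ℝ, 0 < c → (c ^ (-(k + 1)⁻¹)) ^ ((k + 1) / k) = c ^ (-k⁻¹) := by
    intro c hc
    rw [← Real.rpow_mul hc.le]
    congr 1
    field_simp
  simp only [Fin.sum_univ_two, Matrix.cons_val_zero, Matrix.cons_val_one, e1 a u ha hu,
    e1 b v hb hv, e2 a u ha hu, e2 b v hb hv, e3 a ha, e3 b hb] at H
  calc (u + v) ^ (k + 1) ≤ ((a * u ^ (k + 1) + b * v ^ (k + 1)) ^ (1 / (k + 1)) *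
        (a ^ (-k⁻¹) + b ^ (-k⁻¹)) ^ (1 / ((k + 1) / k))) ^ (k + 1) := by
        gcongr
    _ = _ := by
        rw [Real.mul_rpow (by positivity) (by positivity), ← Real.rpow_mul (by positivity),
          ← Real.rpow_mul (by positivity)]
        congr 1
        · rw [one_div_mul_cancel hk1.ne', Real.rpow_one]
        · congr 1
          field_simp

theorem harmonicComb_le_mul {k : ℝ} (hk : 0 < k) {U V : ℝ≥0∞} (hU : U ≠ 0) (hU' : U ≠ ∞)
    (hV : V ≠ 0) (hV' : V ≠ ∞) (A B : ℝ≥0∞) :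
    harmonicComb k A B ≤ harmonicComb (k + 1) U V * (A / U + B / V) := by
  have hk1 : 0 < k + 1 := by linarith
  rcases eq_or_ne A 0 with rfl | hA
  · simp [harmonicComb_zero_left hk]
  rcases eq_or_ne B 0 with rfl | hB
  · simp [harmonicComb_zero_right hk]
  lift U to NNReal using hU'
  lift V to NNReal using hV'
  have hU0 : (0 : ℝ) < U := by
    have : U ≠ 0 := by simpa using hU
    positivity
  have hV0 : (0 : ℝ) < V := by
    have : V ≠ 0 := by simpa using hV
    positivity
  rw [← ENNReal.ofReal_coe_nnreal, ← ENNReal.ofReal_coe_nnreal, harmonicComb_ofReal hU0 hV0]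
  have hc : ENNReal.ofReal (((U : ℝ) ^ (-(k + 1)⁻¹) + (V : ℝ) ^ (-(k + 1)⁻¹)) ^ (-(k + 1))) ≠ 0 := by
    rw [Ne, ENNReal.ofReal_eq_zero, not_le]
    positivity
  rcases eq_or_ne A ∞ with rfl | hA'
  · rw [ENNReal.top_div_of_ne_top (by simp), top_add, ENNReal.mul_top hc]
    exact le_top
  rcases eq_or_ne B ∞ with rfl | hB'
  · rw [ENNReal.top_div_of_ne_top (by simp), add_top, ENNReal.mul_top hc]
    exact le_top
  lift A to NNReal using hA'
  lift B to NNReal using hB'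
  have hA0 : (0 : ℝ) < A := by
    have : A ≠ 0 := by simpa using hA
    positivity
  have hB0 : (0 : ℝ) < B := by
    have : B ≠ 0 := by simpa using hB
    positivity
  rw [← ENNReal.ofReal_coe_nnreal, ← ENNReal.ofReal_coe_nnreal, harmonicComb_ofReal hA0 hB0,
    ← ENNReal.ofReal_div_of_pos hU0, ← ENNReal.ofReal_div_of_pos hV0,
    ← ENNReal.ofReal_add (by positivity) (by positivity), ← ENNReal.ofReal_mul (by positivity)]
  refine ENNReal.ofReal_le_ofReal ?_
  have H := add_rpow_le_holder hk hA0 hB0 (Real.rpow_pos_of_pos hU0 (-(k + 1)⁻¹))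
    (Real.rpow_pos_of_pos hV0 (-(k + 1)⁻¹))
  have e : ∀ w : ℝ, 0 < w → (w ^ (-(k + 1)⁻¹)) ^ (k + 1) = w⁻¹ := fun w hw => by
    rw [← Real.rpow_mul hw.le, neg_mul, inv_mul_cancel₀ hk1.ne', Real.rpow_neg_one]
  rw [e _ hU0, e _ hV0] at H
  rw [Real.rpow_neg (y := k) (by positivity), Real.rpow_neg (y := k + 1) (by positivity),
    inv_mul_eq_div, le_div_iff₀ (by positivity), inv_mul_le_iff₀ (by positivity), div_eq_mul_inv,
    div_eq_mul_inv, mul_comm (_ ^ k)]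
  exact H

theorem harmonicComb_lintegral_le_of_iSup_ne_top {k : ℝ} (hk : 0 < k) {f g h : ℝ → ℝ≥0∞}
    (hf : Measurable f) (hg : Measurable g) (hh : Measurable h)
    (hf' : ⨆ x, f x ≠ ∞) (hg' : ⨆ x, g x ≠ ∞)
    (hfgh : ∀ x y, harmonicComb (k + 1) (f x) (g y) ≤ h (x + y)) :
    harmonicComb k (∫⁻ x, f x) (∫⁻ x, g x) ≤ ∫⁻ x, h x := by
  have hk1 : 0 < k + 1 := by linarith
  set U := ⨆ x, f x with hU
  set V := ⨆ x, g x with hV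
  rcases eq_or_ne U 0 with hU0 | hU0
  · have : ∀ x, f x = 0 := by simpa [hU] using hU0
    simp [this, harmonicComb_zero_left hk]
  rcases eq_or_ne V 0 with hV0 | hV0
  · have : ∀ x, g x = 0 := by simpa [hV] using hV0
    simp [this, harmonicComb_zero_right hk]
  refine (harmonicComb_le_mul hk hU0 hf' hV0 hg' _ _).trans ?_
  set c := harmonicComb (k + 1) U V with hc
  have hUc : ∀ x, f x / U ≤ 1 := fun x => ENNReal.div_le_of_le_mul (by simpa using le_iSup f x)
  have hc0 : c ≠ 0 := by
    simp [hc, harmonicComb, hU0, hV0, hk1, hf', hg', ENNReal.rpow_eq_zero_iff, not_lt.2 hk1.le,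
      ENNReal.rpow_eq_top_iff]
  have hct : c ≠ ∞ := by
    simp [hc, harmonicComb, hU0, hV0, hk1, hf', hg', ENNReal.rpow_eq_zero_iff, not_lt.2 hk1.le,
      ENNReal.rpow_eq_top_iff]
  have main := lintegral_add_lintegral_le_of_min_le (f := fun x => f x / U) (g := fun x => g x / V)
    (h := fun x => h x / c) (hf.div_const _) (hg.div_const _) (hh.div_const _)
    (by rw [← ENNReal.iSup_div, ENNReal.div_self hU0 hf'])
    (by rw [← ENNReal.iSup_div, ENNReal.div_self hV0 hg'])
    (by
      intro x y
      rw [ENNReal.le_div_iff_mul_le (Or.inl hc0) (Or.inl hct)]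
      have hm : min (f x / U) (g y / V) ≠ ∞ :=
        ((min_le_left _ _).trans_lt ((hUc x).trans_lt ENNReal.one_lt_top)).ne
      refine le_trans ?_ (hfgh x y)
      rw [hc, ← harmonicComb_mul hk1 hm]
      refine harmonicComb_mono hk1 ?_ ?_
      · exact (mul_le_mul_left (min_le_left _ _) _).trans (ENNReal.div_mul_cancel hU0 hf').le
      · exact (mul_le_mul_left (min_le_right _ _) _).trans (ENNReal.div_mul_cancel hV0 hg').le)
  simp only [div_eq_mul_inv] at main ⊢
  rw [lintegral_mul_const _ hf, lintegral_mul_const _ hg, lintegral_mul_const _ hh] at main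
  rw [mul_comm c]
  exact (ENNReal.le_div_iff_mul_le (Or.inl hc0) (Or.inl hct)).1 (by simpa [div_eq_mul_inv] using main)

/-- A Borell–Brascamp–Lieb type inequality on `ℝ`. -/
theorem harmonicComb_lintegral_real_le {k : ℝ} (hk : 0 < k) {f g h : ℝ → ℝ≥0∞}
    (hf : Measurable f) (hg : Measurable g) (hh : Measurable h)
    (hfgh : ∀ x y, harmonicComb (k + 1) (f x) (g y) ≤ h (x + y)) :
    harmonicComb k (∫⁻ x, f x) (∫⁻ x, g x) ≤ ∫⁻ x, h x := by
  have hk1 : 0 < k + 1 := by linarith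
  have trunc : ∀ f : ℝ → ℝ≥0∞, Measurable f →
      Tendsto (fun n : ℕ => ∫⁻ x, min (f x) n) atTop (𝓝 (∫⁻ x, f x)) := by
    intro f hf
    refine lintegral_tendsto_of_tendsto_of_monotone (fun n => (hf.min measurable_const).aemeasurable)
      (Eventually.of_forall fun x n m hnm => min_le_min_left _ (by exact_mod_cast hnm))
      (Eventually.of_forall fun x => ?_)
    have := (tendsto_const_nhds (x := f x)).min ENNReal.tendsto_nat_nhds_top
    simpa using this
  refine le_of_tendsto (((continuous_harmonicComb k).tendsto _).comp
    ((trunc f hf).prodMk_nhds (trunc g hg))) (Eventually.of_forall fun n => ?_)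
  have hn : (n : ℝ≥0∞) < ∞ := ENNReal.natCast_lt_top n
  refine harmonicComb_lintegral_le_of_iSup_ne_top hk (hf.min measurable_const)
    (hg.min measurable_const) hh ((iSup_le fun x => min_le_right _ _).trans_lt hn).ne
    ((iSup_le fun x => min_le_right _ _).trans_lt hn).ne fun x y => ?_
  exact (harmonicComb_mono hk1 (min_le_left _ _) (min_le_left _ _)).trans (hfgh x y)

/-- The Borell–Brascamp–Lieb type inequality on `ℝ^n`. -/
theorem harmonicComb_lintegral_pi_le (n : ℕ) {k : ℝ} (hk : 0 < k) {f g h : (Fin n → ℝ) → ℝ≥0∞}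
    (hf : Measurable f) (hg : Measurable g) (hh : Measurable h)
    (hfgh : ∀ x y, harmonicComb (k + n) (f x) (g y) ≤ h (x + y)) :
    harmonicComb k (∫⁻ x, f x) (∫⁻ x, g x) ≤ ∫⁻ x, h x := by
  induction n generalizing k with
  | zero =>
    have := hfgh 0 0
    simpa [Measure.volume_pi_eq_dirac (0 : Fin 0 → ℝ)] using this
  | succ n ih =>
    have e := (volume_preserving_piFinSuccAbove (fun _ : Fin (n + 1) => ℝ) 0).symm
    have split : ∀ f : (Fin (n + 1) → ℝ) → ℝ≥0∞, Measurable f →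
        Measurable (fun p : ℝ × (Fin n → ℝ) => f (Fin.cons p.1 p.2)) ∧
        ∫⁻ x, f x = ∫⁻ y : Fin n → ℝ, ∫⁻ t : ℝ, f (Fin.cons t y) := by
      intro f hf
      have hm : Measurable (fun p : ℝ × (Fin n → ℝ) => f (Fin.cons p.1 p.2)) := by
        have := hf.comp e.measurable
        simpa [Function.comp_def, MeasurableEquiv.piFinSuccAbove, Fin.insertNthEquiv] using this
      refine ⟨hm, ?_⟩
      rw [← e.lintegral_comp hf, Measure.volume_eq_prod]
      have := lintegral_prod_symm' (μ := (volume : Measure ℝ)) (ν := (volume : Measure (Fin n → ℝ)))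
        _ hm
      simpa [MeasurableEquiv.piFinSuccAbove, Fin.insertNthEquiv] using this
    have slice : ∀ f : (Fin (n + 1) → ℝ) → ℝ≥0∞, Measurable f →
        Measurable fun y : Fin n → ℝ => ∫⁻ t : ℝ, f (Fin.cons t y) := fun f hf =>
      (split f hf).1.lintegral_prod_left'
    rw [(split f hf).2, (split g hg).2, (split h hh).2]
    refine ih hk (slice f hf) (slice g hg) (slice h hh) fun x y => ?_
    have sec : ∀ f : (Fin (n + 1) → ℝ) → ℝ≥0∞, Measurable f → ∀ y : Fin n → ℝ,
        Measurable fun t : ℝ => f (Fin.cons t y) := fun f hf y =>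
      (split f hf).1.comp measurable_prodMk_right
    refine harmonicComb_lintegral_real_le (by positivity) (sec f hf x) (sec g hg y)
      (sec h hh (x + y)) fun s t => ?_
    have := hfgh (Fin.cons s x) (Fin.cons t y)
    have e1 : (Fin.cons s x + Fin.cons t y : Fin (n + 1) → ℝ) = Fin.cons (s + t) (x + y) := by
      ext i
      refine Fin.cases ?_ (fun j => ?_) i <;> simp
    rw [e1] at this
    convert this using 2
    push_cast
    ring

theorem perspective_rpow_add_le {r a b u v : ℝ} (hr : 1 ≤ r) (ha : 0 < a) (hb : 0 < b)
    (hu : 0 ≤ u) (hv : 0 ≤ v) :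
    (a + b) * ((u + v) / (a + b)) ^ r ≤ a * (u / a) ^ r + b * (v / b) ^ r := by
  have H := (convexOn_rpow hr).2 (mem_Ici.2 (div_nonneg hu ha.le)) (mem_Ici.2 (div_nonneg hv hb.le))
    (div_nonneg ha.le (add_pos ha hb).le) (div_nonneg hb.le (add_pos ha hb).le)
    (by field_simp)
  simp only [smul_eq_mul] at H
  have e : a / (a + b) * (u / a) + b / (a + b) * (v / b) = (u + v) / (a + b) := by field_simp
  rw [e] at H
  calc (a + b) * ((u + v) / (a + b)) ^ r
      ≤ (a + b) * (a / (a + b) * (u / a) ^ r + b / (a + b) * (v / b) ^ r) := by gcongr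
    _ = _ := by field_simp

theorem perspective_one_add_rpow_le {m q a b u v : ℝ} (hm : 1 ≤ m) (hq : m ≤ q) (ha : 0 < a)
    (hb : 0 < b) (hu : 0 ≤ u) (hv : 0 ≤ v) :
    (a + b) * (1 + ((u + v) / (a + b)) ^ q) ^ m⁻¹ ≤
      a * (1 + (u / a) ^ q) ^ m⁻¹ + b * (1 + (v / b) ^ q) ^ m⁻¹ := by
  have hm0 : 0 < m := by linarith
  have key : ∀ c w : ℝ, 0 < c → 0 ≤ w →
      (c ^ m + (c * (w / c) ^ (q / m)) ^ m) ^ m⁻¹ = c * (1 + (w / c) ^ q) ^ m⁻¹ := by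
    intro c w hc hw
    rw [Real.mul_rpow hc.le (by positivity), ← Real.rpow_mul (by positivity),
      div_mul_cancel₀ _ hm0.ne']
    have : c ^ m + c ^ m * (w / c) ^ q = c ^ m * (1 + (w / c) ^ q) := by ring
    rw [this, Real.mul_rpow (by positivity) (by positivity), ← Real.rpow_mul hc.le,
      mul_inv_cancel₀ hm0.ne', Real.rpow_one]
  have H := Real.Lp_add_le_of_nonneg (Finset.univ : Finset (Fin 2)) hm
    (f := ![a, a * (u / a) ^ (q / m)]) (g := ![b, b * (v / b) ^ (q / m)])
    (by intro i _; fin_cases i <;> simp <;> positivity)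
    (by intro i _; fin_cases i <;> simp <;> positivity)
  simp only [Fin.sum_univ_two, Matrix.cons_val_zero, Matrix.cons_val_one, one_div,
    key a u ha hu, key b v hb hv] at H
  refine le_trans ?_ H
  rw [← key (a + b) (u + v) (by positivity) (by positivity)]
  have := perspective_rpow_add_le (r := q / m) ((one_le_div hm0).2 hq) ha hb hu hv
  gcongr

theorem lintegral_comp_inv_smul {F : Type*} [NormedAddCommGroup F] [NormedSpace ℝ F]
    [FiniteDimensional ℝ F] [MeasurableSpace F] [BorelSpace F] (μ : Measure F) [μ.IsAddHaarMeasure]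
    {c : ℝ} (hc : 0 < c) {f : F → ℝ≥0∞} (hf : Measurable f) :
    ∫⁻ z, f (c⁻¹ • z) ∂μ = ENNReal.ofReal (c ^ Module.finrank ℝ F) * ∫⁻ z, f z ∂μ := by
  rw [← lintegral_map (g := fun z : F => c⁻¹ • z) hf (measurable_const_smul _),
    Measure.map_addHaar_smul μ (inv_ne_zero hc.ne'), lintegral_smul_measure]
  simp [abs_of_pos hc]

section Mobility

variable {E : Type*} [NormedAddCommGroup E] [NormedSpace ℝ E]

/-- The density `a^{-m} (1 + 𝒩(x / a)^q)⁻¹` on the half space `a > 0`, extended by zero. -/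
def projDensity (𝒩 : E → ℝ) (m q a : ℝ) (x : E) : ℝ≥0∞ :=
  if 0 < a then ENNReal.ofReal (a ^ (-m) * (1 + 𝒩 (a⁻¹ • x) ^ q)⁻¹) else 0

theorem harmonicComb_projDensity_le {𝒩 : E → ℝ} (h0 : ∀ x, 0 ≤ 𝒩 x)
    (hs : ∀ (c : ℝ) x, 𝒩 (c • x) = |c| * 𝒩 x) (hadd : ∀ x y, 𝒩 (x + y) ≤ 𝒩 x + 𝒩 y)
    {m q : ℝ} (hm : 1 ≤ m) (hq : m ≤ q) (a b : ℝ) (x y : E) :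
    harmonicComb m (projDensity 𝒩 m q a x) (projDensity 𝒩 m q b y) ≤
      projDensity 𝒩 m q (a + b) (x + y) := by
  have hm0 : 0 < m := by linarith
  by_cases ha : 0 < a
  swap
  · simp [projDensity, ha, harmonicComb_zero_left hm0]
  by_cases hb : 0 < b
  swap
  · simp [projDensity, hb, harmonicComb_zero_right hm0]
  have hab : 0 < a + b := by positivity
  have hpos : ∀ c : ℝ, ∀ z, 0 < c → 0 < 1 + 𝒩 (c⁻¹ • z) ^ q := fun c z hc => by
    have := Real.rpow_nonneg (h0 (c⁻¹ • z)) q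
    linarith
  have key : ∀ c : ℝ, ∀ z, 0 < c → (c ^ (-m) * (1 + 𝒩 (c⁻¹ • z) ^ q)⁻¹) ^ (-m⁻¹) =
      c * (1 + (𝒩 z / c) ^ q) ^ m⁻¹ := by
    intro c z hc
    have h1 := hpos c z hc
    rw [Real.mul_rpow (by positivity) (by positivity), ← Real.rpow_mul hc.le, neg_mul_neg,
      mul_inv_cancel₀ hm0.ne', Real.rpow_one, Real.inv_rpow h1.le, Real.rpow_neg h1.le, inv_inv, hs,
      abs_of_pos (inv_pos.2 hc), inv_mul_eq_div]
  have hp : ∀ c : ℝ, ∀ z, 0 < c → 0 < c ^ (-m) * (1 + 𝒩 (c⁻¹ • z) ^ q)⁻¹ := fun c z hc =>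
    mul_pos (Real.rpow_pos_of_pos hc _) (inv_pos.2 (hpos c z hc))
  simp only [projDensity, ha, hb, hab, if_true]
  rw [harmonicComb_ofReal (hp a x ha) (hp b y hb)]
  refine ENNReal.ofReal_le_ofReal ?_
  rw [key a x ha, key b y hb]
  have e : (a + b) ^ (-m) * (1 + 𝒩 ((a + b)⁻¹ • (x + y)) ^ q)⁻¹ =
      ((a + b) * (1 + (𝒩 (x + y) / (a + b)) ^ q) ^ m⁻¹) ^ (-m) := by
    rw [← key _ _ hab, ← Real.rpow_mul (hp _ _ hab).le, neg_mul_neg, inv_mul_cancel₀ hm0.ne',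
      Real.rpow_one]
  rw [e]
  have hxy := h0 (x + y)
  have hx := h0 x
  have hy := h0 y
  refine Real.rpow_le_rpow_of_nonpos (by positivity) ?_ (by linarith)
  refine le_trans ?_ (perspective_one_add_rpow_le hm hq ha hb hx hy)
  have hq0 : 0 ≤ q := by linarith
  gcongr
  exact hadd x y

/-- The integral of `(1 + 𝒩^q)⁻¹` over the half space spanned by the ray through `v` and the
range of `w`. -/
def halfIntegral {n : ℕ} (𝒩 : E → ℝ) (q : ℝ) (w : (Fin n → ℝ) →L[ℝ] E) (v : E) : ℝ≥0∞ :=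
  ∫⁻ t in Ioi (0 : ℝ), ∫⁻ z, ENNReal.ofReal (1 + 𝒩 (t • v + w z) ^ q)⁻¹

theorem lintegral_Ioi_comp_inv (H : ℝ → ℝ≥0∞) :
    ∫⁻ a in Ioi (0 : ℝ), ENNReal.ofReal (a ^ (-2 : ℝ)) * H a⁻¹ = ∫⁻ t in Ioi (0 : ℝ), H t := by
  have him : (fun a : ℝ => a⁻¹) '' Ioi 0 = Ioi 0 := by
    ext t
    constructor
    · rintro ⟨a, ha, rfl⟩
      exact mem_Ioi.2 (inv_pos.2 (mem_Ioi.1 ha))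
    · intro ht
      exact ⟨t⁻¹, mem_Ioi.2 (inv_pos.2 (mem_Ioi.1 ht)), inv_inv t⟩
  have := lintegral_image_eq_lintegral_abs_deriv_mul (s := Ioi (0 : ℝ)) (f := fun a : ℝ => a⁻¹)
    (f' := fun a => -(a ^ 2)⁻¹) measurableSet_Ioi
    (fun a ha => (hasDerivAt_inv (ne_of_gt ha)).hasDerivWithinAt) (inv_injective.injOn) H
  rw [him] at this
  rw [this]
  refine setLIntegral_congr_fun measurableSet_Ioi fun a ha => ?_
  have ha' : (0 : ℝ) < a := ha
  simp only [abs_neg]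
  rw [abs_of_pos (by positivity), Real.rpow_neg ha'.le]
  norm_num

theorem lintegral_projDensity {n : ℕ} {𝒩 : E → ℝ} (hc : Continuous 𝒩) (q : ℝ) (hq : 0 ≤ q)
    (w : (Fin n → ℝ) →L[ℝ] E) (v : E) :
    ∫⁻ a, ∫⁻ z, projDensity 𝒩 (2 + n) q a (v + w z) = halfIntegral 𝒩 q w v := by
  have hsupp : ∀ a ∉ Ioi (0 : ℝ), ∫⁻ z, projDensity 𝒩 (2 + n) q a (v + w z) = 0 := by
    intro a ha
    have : ¬ 0 < a := ha
    simp [projDensity, this]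
  rw [← setLIntegral_eq_of_support_subset (s := Ioi (0 : ℝ)) (fun a ha => by
    by_contra h
    exact ha (hsupp a h)), halfIntegral,
    ← lintegral_Ioi_comp_inv fun t => ∫⁻ z, ENNReal.ofReal (1 + 𝒩 (t • v + w z) ^ q)⁻¹]
  refine setLIntegral_congr_fun measurableSet_Ioi fun a ha => ?_
  have ha' : (0 : ℝ) < a := ha
  have hm : Measurable fun z : Fin n → ℝ => ENNReal.ofReal (1 + 𝒩 (a⁻¹ • v + w z) ^ q)⁻¹ := by
    have h1 : Continuous fun z : Fin n → ℝ => 𝒩 (a⁻¹ • v + w z) := by fun_prop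
    exact (((h1.rpow_const fun _ => Or.inr hq).const_add 1).measurable.inv).ennreal_ofReal
  have e : ∀ z : Fin n → ℝ, projDensity 𝒩 (2 + n) q a (v + w z) = ENNReal.ofReal (a ^ (-(2 + n : ℝ))) *
      (fun z => ENNReal.ofReal (1 + 𝒩 (a⁻¹ • v + w z) ^ q)⁻¹) (a⁻¹ • z) := fun z => by
    rw [projDensity, if_pos ha', ENNReal.ofReal_mul (by positivity), smul_add]
    simp only [map_smul]
  rw [lintegral_congr e]
  rw [lintegral_const_mul' _ _ ENNReal.ofReal_ne_top, lintegral_comp_inv_smul _ ha' hm,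
    Module.finrank_fin_fun,
    ← mul_assoc, ← ENNReal.ofReal_mul (by positivity), ← Real.rpow_natCast, ← Real.rpow_add ha']
  congr 4
  ring


theorem measurable_lintegral_line {n : ℕ} {𝒩 : E → ℝ} (hc : Continuous 𝒩) (q : ℝ)
    (w : (Fin n → ℝ) →L[ℝ] E) (v : E) :
    Measurable fun t : ℝ => ∫⁻ z, ENNReal.ofReal (1 + 𝒩 (t • v + w z) ^ q)⁻¹ := by
  have h1 : Measurable fun p : ℝ × (Fin n → ℝ) => 𝒩 (p.1 • v + w p.2) :=
    (by fun_prop : Continuous fun p : ℝ × (Fin n → ℝ) => 𝒩 (p.1 • v + w p.2)).measurable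
  exact (((h1.pow_const q).const_add 1).inv.ennreal_ofReal).lintegral_prod_right'

theorem lintegral_line_eq {n : ℕ} {𝒩 : E → ℝ} (hc : Continuous 𝒩)
    (hs : ∀ (c : ℝ) x, 𝒩 (c • x) = |c| * 𝒩 x) (q : ℝ) (w : (Fin n → ℝ) →L[ℝ] E) (v : E)
    {s : ℝ} (hs0 : 0 < s) :
    ∫⁻ t : ℝ, ∫⁻ z, ENNReal.ofReal (1 + 𝒩 (t • s⁻¹ • v + w z) ^ q)⁻¹ =
      ENNReal.ofReal s * (2 * halfIntegral 𝒩 q w v) := by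
  set H : ℝ → ℝ≥0∞ := fun t => ∫⁻ z, ENNReal.ofReal (1 + 𝒩 (t • v + w z) ^ q)⁻¹ with hH
  have hHm : Measurable H := measurable_lintegral_line hc q w v
  have e1 : ∀ t : ℝ, ∫⁻ z, ENNReal.ofReal (1 + 𝒩 (t • s⁻¹ • v + w z) ^ q)⁻¹ = H (s⁻¹ • t) := by
    intro t
    simp only [hH, smul_smul, smul_eq_mul, mul_comm t]
  have heven : ∀ t, H (-t) = H t := by
    intro t
    simp only [hH]
    rw [← lintegral_neg_eq_self]
    refine lintegral_congr fun z => ?_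
    have e2 : -t • v + w (-z) = (-1 : ℝ) • (t • v + w z) := by
      rw [map_neg]
      module
    rw [e2, hs]
    simp
  have hneg : ∫⁻ t in Iic (0 : ℝ), H t = ∫⁻ t in Ioi (0 : ℝ), H t := by
    rw [setLIntegral_congr (Iio_ae_eq_Iic (a := (0 : ℝ)) (μ := volume)).symm,
      ← lintegral_indicator measurableSet_Iio, ← lintegral_indicator measurableSet_Ioi,
      ← lintegral_neg_eq_self]
    refine lintegral_congr fun t => ?_
    by_cases ht : 0 < t
    · rw [indicator_of_mem (by simpa using ht), indicator_of_mem (by simpa using ht), heven]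
    · rw [indicator_of_notMem (by simpa using ht), indicator_of_notMem (by simpa using ht)]
  simp_rw [e1]
  rw [lintegral_comp_inv_smul volume hs0 hHm, Module.finrank_self, pow_one,
    ← lintegral_add_compl H (measurableSet_Ioi (a := (0 : ℝ))), compl_Ioi, hneg, two_mul]
  rfl

variable [MeasurableSpace E] [BorelSpace E]

theorem inv_halfIntegral_add_le {n : ℕ} {𝒩 : E → ℝ} (hc : Continuous 𝒩) (h0 : ∀ x, 0 ≤ 𝒩 x)
    (hs : ∀ (c : ℝ) x, 𝒩 (c • x) = |c| * 𝒩 x) (hadd : ∀ x y, 𝒩 (x + y) ≤ 𝒩 x + 𝒩 y)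
    {q : ℝ} (hq : 2 + n ≤ q) (w : (Fin n → ℝ) →L[ℝ] E) (v₁ v₂ : E) :
    (halfIntegral 𝒩 q w (v₁ + v₂))⁻¹ ≤ (halfIntegral 𝒩 q w v₁)⁻¹ + (halfIntegral 𝒩 q w v₂)⁻¹ := by
  have hn : (0 : ℝ) ≤ n := Nat.cast_nonneg n
  have hq0 : 0 ≤ q := by linarith
  have hjm : ∀ v : E, Measurable fun p : ℝ × (Fin n → ℝ) =>
      projDensity 𝒩 (2 + n) q p.1 (v + w p.2) := by
    intro v
    refine Measurable.ite (measurableSet_lt measurable_const measurable_fst) ?_ measurable_const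
    have hcm : Measurable fun p : ℝ × (Fin n → ℝ) => 𝒩 (p.1⁻¹ • (v + w p.2)) := by
      refine hc.measurable.comp (measurable_fst.inv.smul ?_)
      exact (by fun_prop : Continuous fun p : ℝ × (Fin n → ℝ) => v + w p.2).measurable
    exact (((measurable_fst.pow_const _)).mul
      (((hcm.pow_const q).const_add 1).inv)).ennreal_ofReal
  have key := harmonicComb_lintegral_real_le (k := 1) one_pos
    (hjm v₁).lintegral_prod_right' (hjm v₂).lintegral_prod_right'
    (hjm (v₁ + v₂)).lintegral_prod_right' (fun a b => by
      refine harmonicComb_lintegral_pi_le n (by norm_num)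
        ((hjm v₁).comp measurable_prodMk_left) ((hjm v₂).comp measurable_prodMk_left)
        ((hjm (v₁ + v₂)).comp measurable_prodMk_left) fun x y => ?_
      have := harmonicComb_projDensity_le h0 hs hadd (m := 2 + n) (by linarith) hq a b
        (v₁ + w x) (v₂ + w y)
      convert this using 2
      · norm_num
      · rw [map_add]
        abel)
  simp only [lintegral_projDensity hc q hq0] at key
  simp only [harmonicComb, inv_one, ENNReal.rpow_neg_one] at key
  exact ENNReal.inv_le_iff_inv_le.1 key
end Mobility

section Hyperplane

variable {n : ℕ}

local notation "𝔼" k => EuclideanSpace ℝ (Fin k)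

theorem lintegral_euclideanSpace_succ {f : (𝔼 (n + 1)) → ℝ≥0∞} (hf : Measurable f) :
    ∫⁻ y, f y = ∫⁻ t : ℝ, ∫⁻ z : Fin n → ℝ, f (WithLp.toLp 2 (Fin.cons t z)) := by
  have e := (volume_preserving_piFinSuccAbove (fun _ : Fin (n + 1) => ℝ) 0).symm
  have e' := (PiLp.volume_preserving_toLp (Fin (n + 1))).comp e
  have hm := hf.comp e'.measurable
  rw [← e'.lintegral_comp hf, Measure.volume_eq_prod]
  have := lintegral_prod (μ := (volume : Measure ℝ)) (ν := (volume : Measure (Fin n → ℝ)))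
    _ hm.aemeasurable
  simpa [MeasurableEquiv.piFinSuccAbove, Fin.insertNthEquiv, Function.comp_def] using this

theorem isAddHaarMeasure_hausdorffMeasure_euclideanSpace (k : ℕ) :
    (μH[(k : ℝ)] : Measure (𝔼 k)).IsAddHaarMeasure := by
  have := isAddHaarMeasure_hausdorffMeasure (E := 𝔼 k)
  rwa [finrank_euclideanSpace_fin] at this

theorem exists_lintegral_range_hausdorffMeasure (k : ℕ) :
    ∃ κ : NNReal, κ ≠ 0 ∧ ∀ (m : ℕ) (L : (𝔼 k) →ₗᵢ[ℝ] 𝔼 m) (f : (𝔼 m) → ℝ≥0∞), Measurable f →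
      ∫⁻ x in range L, f x ∂μH[(k : ℝ)] = κ * ∫⁻ y, f (L y) := by
  have := isAddHaarMeasure_hausdorffMeasure_euclideanSpace k
  refine ⟨Measure.addHaarScalarFactor (μH[(k : ℝ)] : Measure (𝔼 k)) volume,
    (Measure.addHaarScalarFactor_pos_of_isAddHaarMeasure _ _).ne', fun m L f hf => ?_⟩
  rw [← L.isometry.map_hausdorffMeasure (Or.inl (Nat.cast_nonneg k)),
    lintegral_map hf L.continuous.measurable]
  have hμ := Measure.isAddLeftInvariant_eq_smul (μH[(k : ℝ)] : Measure (𝔼 k)) volume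
  generalize Measure.addHaarScalarFactor (μH[(k : ℝ)] : Measure (𝔼 k)) volume = κ at hμ ⊢
  rw [hμ, lintegral_smul_measure]
  rfl

/-- The coordinates of an orthonormal basis but the first one parametrize the orthogonal complement
of its first vector. -/
theorem exists_linearIsometry_range_eq (d : OrthonormalBasis (Fin (n + 1)) ℝ (𝔼 (n + 1))) :
    ∃ L : (𝔼 n) →ₗᵢ[ℝ] 𝔼 (n + 1), (∀ y, L y = ∑ i, y i • d i.succ) ∧
      range L = {x | ⟪x, d 0⟫ = 0} := by
  let ι : (𝔼 n) →ₗᵢ[ℝ] 𝔼 (n + 1) :=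
    { toFun := fun y => WithLp.toLp 2 (Fin.cons 0 y.ofLp)
      map_add' := fun x y => by
        ext i
        refine Fin.cases ?_ (fun j => ?_) i <;> simp
      map_smul' := fun c y => by
        ext i
        refine Fin.cases ?_ (fun j => ?_) i <;> simp
      norm_map' := fun y => by simp [EuclideanSpace.norm_eq, Fin.sum_univ_succ] }
  refine ⟨d.repr.symm.toLinearIsometry.comp ι, fun y => ?_, ?_⟩
  · change d.repr.symm (ι y) = _
    rw [← d.sum_repr_symm]
    simp [Fin.sum_univ_succ, ι]
  · ext x
    constructor
    · rintro ⟨y, rfl⟩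
      change ⟪d.repr.symm (ι y), d 0⟫ = 0
      rw [real_inner_comm, ← d.repr_apply_apply, LinearIsometryEquiv.apply_symm_apply]
      simp [ι]
    · intro hx
      have hx' : ⟪x, d 0⟫ = 0 := hx
      refine ⟨WithLp.toLp 2 fun i => d.repr x i.succ, ?_⟩
      change d.repr.symm (ι _) = x
      rw [LinearIsometryEquiv.symm_apply_eq]
      ext i
      refine Fin.cases ?_ (fun j => ?_) i
      · rw [d.repr_apply_apply, real_inner_comm, hx']
        simp [ι]
      · simp [ι]

/-- The quarter turn in the plane spanned by the first two vectors of an orthonormal basis. -/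
def quarterTurn (b : OrthonormalBasis (Fin (n + 2)) ℝ (𝔼 (n + 2))) (p : 𝔼 (n + 2)) : 𝔼 (n + 2) :=
  ⟪b 0, p⟫ • b 1 - ⟪b 1, p⟫ • b 0

theorem quarterTurn_add (b : OrthonormalBasis (Fin (n + 2)) ℝ (𝔼 (n + 2))) (p p' : 𝔼 (n + 2)) :
    quarterTurn b (p + p') = quarterTurn b p + quarterTurn b p' := by
  simp only [quarterTurn, inner_add_right]
  module

/-- The linear map sending the standard basis to the vectors of an orthonormal basis with indices
at least `2`. -/
def restMap (b : OrthonormalBasis (Fin (n + 2)) ℝ (𝔼 (n + 2))) : (Fin n → ℝ) →L[ℝ] 𝔼 (n + 2) :=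
  LinearMap.toContinuousLinearMap (Fintype.linearCombination ℝ fun i : Fin n => b i.succ.succ)

theorem restMap_apply (b : OrthonormalBasis (Fin (n + 2)) ℝ (𝔼 (n + 2))) (z : Fin n → ℝ) :
    restMap b z = ∑ i, z i • b i.succ.succ := by
  simp [restMap, Fintype.linearCombination_apply]

theorem exists_orthonormalBasis_rotated (b : OrthonormalBasis (Fin (n + 2)) ℝ (𝔼 (n + 2)))
    {p : 𝔼 (n + 2)} (hp : p ≠ 0) (hpb : ∀ i : Fin n, ⟪b i.succ.succ, p⟫ = 0) :
    ∃ d : OrthonormalBasis (Fin (n + 2)) ℝ (𝔼 (n + 2)), d 0 = ‖p‖⁻¹ • p ∧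
      d 1 = ‖p‖⁻¹ • quarterTurn b p ∧ ∀ i : Fin n, d i.succ.succ = b i.succ.succ := by
  have hp0 : ‖p‖ ≠ 0 := norm_ne_zero_iff.2 hp
  have hpe : ⟪b 0, p⟫ • b 0 + ⟪b 1, p⟫ • b 1 = p := by
    conv_rhs => rw [← b.sum_repr' p]
    simp [Fin.sum_univ_succ, hpb]
  have hb : ∀ i j, ⟪b i, b j⟫ = if i = j then (1 : ℝ) else 0 := orthonormal_iff_ite.1 b.orthonormal
  have hnorm : ⟪b 0, p⟫ * ⟪b 0, p⟫ + ⟪b 1, p⟫ * ⟪b 1, p⟫ = ‖p‖ * ‖p‖ := by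
    have : ⟪p, p⟫ = ⟪⟪b 0, p⟫ • b 0 + ⟪b 1, p⟫ • b 1, p⟫ := by rw [hpe]
    rw [← real_inner_self_eq_norm_mul_norm, this, inner_add_left, real_inner_smul_left,
      real_inner_smul_left]
  set α := ⟪b 0, p⟫ with hα
  set β := ⟪b 1, p⟫ with hβ
  let v : Fin (n + 2) → 𝔼 (n + 2) :=
    Fin.cons (‖p‖⁻¹ • p) (Fin.cons (‖p‖⁻¹ • quarterTurn b p) fun i => b i.succ.succ)
  have h01 : (0 : Fin (n + 2)) ≠ 1 := by simp
  have h0s : ∀ i : Fin n, (0 : Fin (n + 2)) ≠ i.succ.succ := fun i => (Fin.succ_ne_zero _).symm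
  have h1s : ∀ i : Fin n, (1 : Fin (n + 2)) ≠ i.succ.succ := fun i h => by
    have := congrArg Fin.val h
    simp at this
  have hpp : ⟪p, p⟫ = ‖p‖ * ‖p‖ := real_inner_self_eq_norm_mul_norm p
  have hpq : ⟪p, quarterTurn b p⟫ = 0 := by
    rw [quarterTurn, inner_sub_right, inner_smul_right, inner_smul_right, real_inner_comm _ p,
      real_inner_comm _ p]
    ring
  have hqq : ⟪quarterTurn b p, quarterTurn b p⟫ = ‖p‖ * ‖p‖ := by
    rw [← hnorm]
    simp only [quarterTurn, inner_sub_left, inner_sub_right, inner_smul_left, inner_smul_right, hb,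
      h01, h01.symm, if_true, if_false, ← hα, ← hβ]
    simp
  have hqs : ∀ i : Fin n, ⟪b i.succ.succ, quarterTurn b p⟫ = 0 := by
    intro i
    simp [quarterTurn, inner_sub_right, inner_smul_right, hb, (h0s i).symm, (h1s i).symm]
  have hpb' : ∀ i : Fin n, ⟪p, b i.succ.succ⟫ = 0 := fun i => by rw [real_inner_comm, hpb]
  have hqs' : ∀ i : Fin n, ⟪quarterTurn b p, b i.succ.succ⟫ = 0 := fun i => by
    rw [real_inner_comm, hqs]
  have hqp : ⟪quarterTurn b p, p⟫ = 0 := by rw [real_inner_comm, hpq]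
  have hv : Orthonormal ℝ v := by
    rw [orthonormal_iff_ite]
    intro i j
    refine Fin.cases ?_ (fun i => Fin.cases ?_ (fun i => ?_) i) i <;>
    refine Fin.cases ?_ (fun j => Fin.cases ?_ (fun j => ?_) j) j
    · simp only [v, Fin.cons_zero, inner_smul_left, inner_smul_right, hpp]
      simp
      field_simp
    · simp [v, inner_smul_left, inner_smul_right, hpq]
    · simp [v, inner_smul_left, hpb', h0s]
    · simp [v, inner_smul_left, inner_smul_right, hqp]
    · simp only [v, Fin.cons_zero, Fin.cons_succ, inner_smul_left, inner_smul_right, hqq]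
      simp
      field_simp
    · have := h1s j
      simp [v, inner_smul_left, hqs', this]
    · simp [v, inner_smul_right, hpb]
    · have := (h1s i).symm
      simp [v, inner_smul_right, hqs, this]
    · simp [v, hb]
  obtain ⟨d, hd⟩ := Orthonormal.exists_orthonormalBasis_extension_of_card_eq (𝕜 := ℝ)
    (ι := Fin (n + 2)) (v := v) (s := univ) (by simp)
    (hv.comp _ Subtype.val_injective)
  exact ⟨d, hd 0 (mem_univ _), hd 1 (mem_univ _), fun i => hd _ (mem_univ _)⟩

theorem IsNorm.continuous {N : ℕ} {𝒩 : EuclideanSpace ℝ (Fin N) → ℝ} (h : IsNorm 𝒩) :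
    Continuous 𝒩 := by
  have hconv : ConvexOn ℝ univ 𝒩 := ⟨convex_univ, fun x _ y _ a b ha hb _ => by
    refine (h.2.2.2 _ _).trans ?_
    rw [h.2.2.1, h.2.2.1, abs_of_nonneg ha, abs_of_nonneg hb]
    rfl⟩
  exact hconv.locallyLipschitz.continuous

theorem IsNorm.exists_mul_norm_le {N : ℕ} {𝒩 : EuclideanSpace ℝ (Fin N) → ℝ} (h : IsNorm 𝒩) :
    ∃ c : ℝ, 0 < c ∧ c ≤ 1 ∧ ∀ x, c * ‖x‖ ≤ 𝒩 x := by
  rcases (sphere (0 : EuclideanSpace ℝ (Fin N)) 1).eq_empty_or_nonempty with he | hne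
  · refine ⟨1, one_pos, le_rfl, fun x => ?_⟩
    have hx : x = 0 := by
      by_contra hx
      have : ‖x‖⁻¹ • x ∈ sphere (0 : EuclideanSpace ℝ (Fin N)) 1 := by
        simp [norm_smul, hx]
      simp [he] at this
    simp [hx, (h.2.1 0).2 rfl]
  · obtain ⟨m, hm, hmin⟩ := (isCompact_sphere (0 : EuclideanSpace ℝ (Fin N)) 1).exists_isMinOn hne
      h.continuous.continuousOn
    have hm1 : ‖m‖ = 1 := by simpa using hm
    have hm0 : 0 < 𝒩 m := (h.1 m).lt_of_ne fun h0 => by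
      rw [(h.2.1 m).1 h0.symm] at hm1
      simp at hm1
    refine ⟨min (𝒩 m) 1, by positivity, min_le_right _ _, fun x => ?_⟩
    rcases eq_or_ne x 0 with rfl | hx
    · simp [(h.2.1 0).2 rfl]
    · have hx0 : 0 < ‖x‖ := norm_pos_iff.2 hx
      have h1 : 𝒩 m ≤ 𝒩 (‖x‖⁻¹ • x) := hmin (by simp [norm_smul, hx])
      rw [h.2.2.1, abs_of_pos (inv_pos.2 hx0), inv_mul_eq_div, le_div_iff₀ hx0] at h1
      exact (mul_le_mul_of_nonneg_right (min_le_left _ _) hx0.le).trans h1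

theorem inv_one_add_rpow_le {c s r q : ℝ} (hc : 0 < c) (hc1 : c ≤ 1) (hs : 0 ≤ s) (hsr : c * s ≤ r)
    (hq : 0 ≤ q) : (1 + r ^ q)⁻¹ ≤ ((c / 2) ^ q)⁻¹ * (1 + s) ^ (-q) := by
  have hr : 0 ≤ r := (by positivity : 0 ≤ c * s).trans hsr
  rw [Real.rpow_neg (by positivity), ← mul_inv, ← Real.mul_rpow (by positivity) (by positivity)]
  refine inv_anti₀ (by positivity) ?_
  have hmax : c / 2 * (1 + s) ≤ max 1 r := by
    rcases le_total s 1 with h | h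
    · exact le_max_of_le_left (by nlinarith)
    · exact le_max_of_le_right (by nlinarith)
  refine (Real.rpow_le_rpow (by positivity) hmax hq).trans ?_
  have := Real.rpow_nonneg hr q
  rcases max_cases 1 r with ⟨h, -⟩ | ⟨h, -⟩ <;> rw [h]
  · simpa using this
  · linarith

theorem IsNorm.lintegral_comp_isometry_ne_top {k N : ℕ} {𝒩 : (𝔼 N) → ℝ} (h : IsNorm 𝒩) {q : ℝ}
    (hq : k < q) (L : (𝔼 k) →ₗᵢ[ℝ] 𝔼 N) :
    ∫⁻ y, ENNReal.ofReal (1 + 𝒩 (L y) ^ q)⁻¹ ≠ ⊤ := by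
  obtain ⟨c, hc, hc1, hle⟩ := h.exists_mul_norm_le
  have hq0 : 0 ≤ q := (Nat.cast_nonneg k).trans hq.le
  have hfin := finite_integral_one_add_norm (E := 𝔼 k) (μ := volume) (r := q) (by simpa using hq)
  refine ne_top_of_le_ne_top
    (ENNReal.mul_ne_top (ENNReal.ofReal_ne_top (r := ((c / 2) ^ q)⁻¹)) hfin.ne) ?_
  rw [← lintegral_const_mul' _ _ ENNReal.ofReal_ne_top]
  refine lintegral_mono fun y => ?_
  rw [← ENNReal.ofReal_mul (by positivity)]
  refine ENNReal.ofReal_le_ofReal (inv_one_add_rpow_le hc hc1 (norm_nonneg y) ?_ hq0)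
  simpa using hle (L y)

theorem IsNorm.lintegral_comp_isometry_ne_zero {k N : ℕ} {𝒩 : (𝔼 N) → ℝ} (h : IsNorm 𝒩) (q : ℝ)
    (L : (𝔼 k) →ₗᵢ[ℝ] 𝔼 N) : ∫⁻ y, ENNReal.ofReal (1 + 𝒩 (L y) ^ q)⁻¹ ≠ 0 := by
  have hm : Measurable fun y => ENNReal.ofReal (1 + 𝒩 (L y) ^ q)⁻¹ :=
    (((h.continuous.comp L.continuous).measurable.pow_const q).const_add 1).inv.ennreal_ofReal
  have hpos : ∀ y, ENNReal.ofReal (1 + 𝒩 (L y) ^ q)⁻¹ ≠ 0 := fun y => by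
    have := Real.rpow_nonneg (h.1 (L y)) q
    rw [ne_eq, ENNReal.ofReal_eq_zero, not_le]
    positivity
  refine (lintegral_pos_iff_support hm).2 ?_ |>.ne'
  rw [Function.support_eq_univ hpos]
  exact Measure.measure_univ_pos.2 (NeZero.ne _)

/-- A parametrization of `p^⊥` under which the integral of `(1 + 𝒩 ^ q)⁻¹` becomes a
`halfIntegral`. -/
theorem exists_linearIsometry_lintegral_eq_halfIntegral
    (b : OrthonormalBasis (Fin (n + 2)) ℝ (𝔼 (n + 2))) {p : 𝔼 (n + 2)} (hp : p ≠ 0)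
    (hpb : ∀ i : Fin n, ⟪b i.succ.succ, p⟫ = 0) :
    ∃ L : (𝔼 (n + 1)) →ₗᵢ[ℝ] 𝔼 (n + 2), range L = {x | ⟪x, p⟫ = 0} ∧
      ∀ (𝒩 : (𝔼 (n + 2)) → ℝ) (_ : Continuous 𝒩) (_ : ∀ (c : ℝ) x, 𝒩 (c • x) = |c| * 𝒩 x) (q : ℝ),
        ∫⁻ y, ENNReal.ofReal (1 + 𝒩 (L y) ^ q)⁻¹ =
          ENNReal.ofReal ‖p‖ * (2 * halfIntegral 𝒩 q (restMap b) (quarterTurn b p)) := by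
  obtain ⟨d, hd0, hd1, hds⟩ := exists_orthonormalBasis_rotated b hp hpb
  obtain ⟨L, hL, hrange⟩ := exists_linearIsometry_range_eq d
  refine ⟨L, ?_, fun 𝒩 hc hs q => ?_⟩
  · rw [hrange]
    ext x
    simp [hd0, inner_smul_right, hp]
  · have hm : Measurable fun y => ENNReal.ofReal (1 + 𝒩 (L y) ^ q)⁻¹ :=
      (((hc.comp L.continuous).measurable.pow_const q).const_add 1).inv.ennreal_ofReal
    rw [lintegral_euclideanSpace_succ hm, ← lintegral_line_eq hc hs q _ _ (norm_pos_iff.2 hp)]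
    refine lintegral_congr fun t => lintegral_congr fun z => ?_
    have : L (WithLp.toLp 2 (Fin.cons t z)) = t • ‖p‖⁻¹ • quarterTurn b p + restMap b z := by
      rw [hL, Fin.sum_univ_succ, restMap_apply, ← hd1]
      simp [hds]
    rw [this]

theorem IsNorm.halfIntegral_ne_zero_ne_top {𝒩 : (𝔼 (n + 2)) → ℝ} (h : IsNorm 𝒩) {q : ℝ}
    (hq : 2 + n ≤ q) (b : OrthonormalBasis (Fin (n + 2)) ℝ (𝔼 (n + 2))) {p : 𝔼 (n + 2)}
    (hp : p ≠ 0) (hpb : ∀ i : Fin n, ⟪b i.succ.succ, p⟫ = 0) :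
    halfIntegral 𝒩 q (restMap b) (quarterTurn b p) ≠ 0 ∧
      halfIntegral 𝒩 q (restMap b) (quarterTurn b p) ≠ ⊤ := by
  obtain ⟨L, -, hL⟩ := exists_linearIsometry_lintegral_eq_halfIntegral b hp hpb
  specialize hL 𝒩 h.continuous h.2.2.1 q
  have h0 := h.lintegral_comp_isometry_ne_zero q L
  have h1 := h.lintegral_comp_isometry_ne_top (q := q) (by push_cast; linarith) L
  rw [hL] at h0 h1
  refine ⟨fun h2 => by simp [h2] at h0, fun h2 => ?_⟩
  simp [h2, ENNReal.mul_top, hp] at h1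

theorem exists_norm_mul_inv_integral_eq (n : ℕ) :
    ∃ κ : ℝ, 0 ≤ κ ∧ ∀ (𝒩 : (𝔼 (n + 2)) → ℝ) (_ : IsNorm 𝒩) (q : ℝ)
      (b : OrthonormalBasis (Fin (n + 2)) ℝ (𝔼 (n + 2))) (p : 𝔼 (n + 2)) (_ : p ≠ 0)
      (_ : ∀ i : Fin n, ⟪b i.succ.succ, p⟫ = 0),
      ‖p‖ * (2 * ∫ x in {x | ⟪x, p⟫ = 0}, (1 + 𝒩 x ^ q)⁻¹ ∂μH[((n + 1 : ℕ) : ℝ)])⁻¹ =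
        κ * ((halfIntegral 𝒩 q (restMap b) (quarterTurn b p))⁻¹).toReal := by
  obtain ⟨κ, hκ, hμ⟩ := exists_lintegral_range_hausdorffMeasure (n + 1)
  refine ⟨(4 * κ)⁻¹, by positivity, fun 𝒩 h q b p hp hpb => ?_⟩
  obtain ⟨L, hrange, hL⟩ := exists_linearIsometry_lintegral_eq_halfIntegral b hp hpb
  have hm : Measurable fun x => (1 + 𝒩 x ^ q)⁻¹ :=
    ((h.continuous.measurable.pow_const q).const_add 1).inv
  rw [integral_eq_lintegral_of_nonneg_ae (ae_of_all _ fun x => by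
      have := Real.rpow_nonneg (h.1 x) q
      simp only [Pi.zero_apply]
      positivity) hm.aestronglyMeasurable,
    ← hrange, hμ _ _ _ hm.ennreal_ofReal, hL 𝒩 h.continuous h.2.2.1 q]
  have hp0 : ‖p‖ ≠ 0 := norm_ne_zero_iff.2 hp
  simp only [ENNReal.toReal_mul, ENNReal.toReal_ofReal (norm_nonneg p), ENNReal.toReal_inv,
    ENNReal.coe_toReal, ENNReal.toReal_ofNat, mul_inv]
  field_simp
  norm_num

theorem exists_orthonormalBasis_inner_eq_zero (p p' : 𝔼 (n + 2)) :
    ∃ b : OrthonormalBasis (Fin (n + 2)) ℝ (𝔼 (n + 2)),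
      ∀ i : Fin n, ⟪b i.succ.succ, p⟫ = 0 ∧ ⟪b i.succ.succ, p'⟫ = 0 := by
  let f : Fin (n + 2) → 𝔼 (n + 2) := Fin.cons p (Fin.cons p' 0)
  refine ⟨InnerProductSpace.gramSchmidtOrthonormalBasis (𝕜 := ℝ) (by simp) f, fun i => ⟨?_, ?_⟩⟩
  · exact InnerProductSpace.gramSchmidtOrthonormalBasis_inv_triangular (by simp) f
      (i := 0) (j := i.succ.succ) (Fin.succ_pos _)
  · exact InnerProductSpace.gramSchmidtOrthonormalBasis_inv_triangular (by simp) f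
      (i := 1) (j := i.succ.succ) (by simp [Fin.lt_def])

theorem convexOn_univ_of_subadditive {E : Type*} [AddCommGroup E] [Module ℝ E] {Φ : E → ℝ}
    (hadd : ∀ x y, Φ (x + y) ≤ Φ x + Φ y) (hsmul : ∀ (c : ℝ), 0 ≤ c → ∀ x, Φ (c • x) = c * Φ x) :
    ConvexOn ℝ univ Φ :=
  ⟨convex_univ, fun x _ y _ a b ha hb _ => by
    simpa only [hsmul a ha, hsmul b hb, smul_eq_mul] using hadd (a • x) (b • y)⟩

end Hyperplane

theorem stmt_7 (N : ℕ) (hN : 2 ≤ N) (𝒩 : EuclideanSpace ℝ (Fin N) → ℝ) (h𝒩 : IsNorm 𝒩)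
    (α : ℝ) (hα1 : 0 < α) (hα2 : α < 2) :
    ConvexOn ℝ univ (fun p : EuclideanSpace ℝ (Fin N) =>
      if p = 0 then 0 else
        ‖p‖ * (2 * ∫ x in {x : EuclideanSpace ℝ (Fin N) | ⟪x, p⟫ = 0},
            (1 + 𝒩 x ^ ((N:ℝ) + α))⁻¹ ∂μH[(N:ℝ) - 1])⁻¹) := by
  obtain ⟨n, rfl⟩ := Nat.exists_eq_add_of_le' hN
  have hd : ((n + 2 : ℕ) : ℝ) - 1 = ((n + 1 : ℕ) : ℝ) := by
    push_cast
    ring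
  have hq : 2 + (n : ℝ) ≤ ((n + 2 : ℕ) : ℝ) + α := by
    push_cast
    linarith
  rw [hd]
  generalize ((n + 2 : ℕ) : ℝ) + α = q at hq
  obtain ⟨κ, hκ, hΦ⟩ := exists_norm_mul_inv_integral_eq n
  refine convexOn_univ_of_subadditive (fun p p' => ?_) fun c hc p => ?_
  · obtain ⟨b, hb⟩ := exists_orthonormalBasis_inner_eq_zero p p'
    rcases eq_or_ne p 0 with rfl | hp
    · simp
    rcases eq_or_ne p' 0 with rfl | hp'
    · simp
    have hb1 : ∀ i : Fin n, ⟪b i.succ.succ, p⟫ = 0 := fun i => (hb i).1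
    have hb2 : ∀ i : Fin n, ⟪b i.succ.succ, p'⟫ = 0 := fun i => (hb i).2
    have hbs : ∀ i : Fin n, ⟪b i.succ.succ, p + p'⟫ = 0 := fun i => by
      rw [inner_add_right, hb1, hb2, add_zero]
    rw [if_neg hp, if_neg hp', hΦ 𝒩 h𝒩 q b p hp hb1, hΦ 𝒩 h𝒩 q b p' hp' hb2]
    split_ifs with hs
    · positivity
    rw [hΦ 𝒩 h𝒩 q b _ hs hbs, ← mul_add, quarterTurn_add]
    have hne1 := ENNReal.inv_ne_top.2 (h𝒩.halfIntegral_ne_zero_ne_top hq b hp hb1).1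
    have hne2 := ENNReal.inv_ne_top.2 (h𝒩.halfIntegral_ne_zero_ne_top hq b hp' hb2).1
    rw [← ENNReal.toReal_add hne1 hne2]
    gcongr
    · exact ENNReal.add_ne_top.2 ⟨hne1, hne2⟩
    · exact inv_halfIntegral_add_le h𝒩.continuous h𝒩.1 h𝒩.2.2.1 h𝒩.2.2.2 hq _ _ _
  · rcases hc.eq_or_lt with rfl | hc
    · simp
    rcases eq_or_ne p 0 with rfl | hp
    · simp
    rw [if_neg hp, if_neg (smul_ne_zero hc.ne' hp), norm_smul, Real.norm_of_nonneg hc.le, mul_assoc]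
    simp [inner_smul_right, hc.ne']
end
end

section
/- Let 𝒩 be a norm on ℝ², α ∈ (0,2), λ_α = ( 4 ∫₀^∞ (1 + t^{2+α})^{−1} dt )^{−1}, and let Φ_α be the mobility norm, Φ_α(0) = 0 and Φ_α(p) = |p| · ( 2 ∫_{p^⊥} (1 + 𝒩(x)^{2+α})^{−1} dH¹(x) )^{−1} for p ≠ 0. Let a, b > 0 and q ∈ [1,∞) ∪ {∞}. If {Φ_α ≤ 1} = {(p₁,p₂) : p₁²/a² + p₂²/b² ≤ 1}, then {𝒩 ≤ 1} = {(p₁,p₂) : p₁²/b² + p₂²/a² ≤ λ_α²}; and if {Φ_α ≤ 1} = {p : ‖p‖_q ≤ 1} (with ‖·‖_q the ℓ^q norm on ℝ²), then {𝒩 ≤ 1} = {p : ‖p‖_q ≤ λ_α}. -/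
open MeasureTheory Metric Set Filter
open scoped RealInnerProductSpace Classical Topology ENNReal

noncomputable section

theorem integrableOn_Ioi_inv_one_add_rpow {s : ℝ} (hs : 2 ≤ s) :
    IntegrableOn (fun t : ℝ => (1 + t ^ s)⁻¹) (Ioi 0) := by
  refine Integrable.mono' (integrable_inv_one_add_sq.const_mul 2).integrableOn
    (by fun_prop) ?_
  filter_upwards [ae_restrict_mem measurableSet_Ioi] with t ht
  have ht : 0 < t := ht
  have hpos : 0 < t ^ s := Real.rpow_pos_of_pos ht s
  rw [Real.norm_of_nonneg (by positivity), ← div_eq_mul_inv, inv_eq_one_div,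
    div_le_div_iff₀ (by positivity) (by positivity)]
  rcases le_total t 1 with h | h
  · nlinarith
  · have : t ^ (2 : ℝ) ≤ t ^ s := Real.rpow_le_rpow_of_exponent_le h hs
    rw [Real.rpow_two] at this
    linarith

theorem integral_Ioi_inv_one_add_rpow_pos {s : ℝ} (hs : 2 ≤ s) :
    0 < ∫ t in Ioi (0 : ℝ), (1 + t ^ s)⁻¹ := by
  have hpos : ∀ t ∈ Ioi (0 : ℝ), 0 < (1 + t ^ s)⁻¹ := fun t ht => by
    have : 0 < t ^ s := Real.rpow_pos_of_pos ht s
    positivity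
  rw [setIntegral_pos_iff_support_of_nonneg_ae _ (integrableOn_Ioi_inv_one_add_rpow hs)]
  · have hsub : Ioi (0 : ℝ) ⊆ Function.support fun t : ℝ => (1 + t ^ s)⁻¹ :=
      fun t ht => (hpos t ht).ne'
    rw [inter_eq_self_of_subset_right hsub]
    simp
  · filter_upwards [ae_restrict_mem measurableSet_Ioi] with t ht using (hpos t ht).le

/-- The integral over the line orthogonal to `p`, parametrized by arc length. -/
theorem setIntegral_orthogonal_hausdorffMeasure (f : EuclideanSpace ℝ (Fin 2) → ℝ)
    {p : EuclideanSpace ℝ (Fin 2)} (hp : p ≠ 0) :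
    ∫ x in {x : EuclideanSpace ℝ (Fin 2) | ⟪x, p⟫ = 0}, f x ∂μH[(1 : ℝ)] =
      ∫ t : ℝ, f (t • (‖p‖⁻¹ • !₂[-p 1, p 0])) := by
  have hp' : ‖p‖ ≠ 0 := norm_ne_zero_iff.mpr hp
  have hsq : ‖p‖ ^ 2 = p 0 ^ 2 + p 1 ^ 2 := by
    simp [EuclideanSpace.norm_sq_eq, Fin.sum_univ_two]
  set e : EuclideanSpace ℝ (Fin 2) := ‖p‖⁻¹ • !₂[-p 1, p 0] with he
  have hrot : ‖(!₂[-p 1, p 0] : EuclideanSpace ℝ (Fin 2))‖ = ‖p‖ := by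
    rw [← sq_eq_sq₀ (norm_nonneg _) (norm_nonneg _), hsq]
    simp [EuclideanSpace.norm_sq_eq, Fin.sum_univ_two, add_comm]
  have hen : ‖e‖ = 1 := by
    rw [he, norm_smul, hrot, norm_inv, norm_norm, inv_mul_cancel₀ hp']
  have hiso : Isometry fun t : ℝ => t • e := by
    refine Isometry.of_dist_eq fun x y => ?_
    rw [dist_eq_norm, ← sub_smul, norm_smul, hen, mul_one, dist_eq_norm]
  have hrange : {x : EuclideanSpace ℝ (Fin 2) | ⟪x, p⟫ = 0} = range fun t : ℝ => t • e := by
    ext x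
    simp only [mem_ofPred_eq, mem_range, PiLp.inner_apply, Fin.sum_univ_two, RCLike.inner_apply,
      conj_trivial]
    constructor
    · intro h
      refine ⟨‖p‖⁻¹ * (x 1 * p 0 - x 0 * p 1), ?_⟩
      ext i
      fin_cases i <;> simp [he] <;> field_simp <;> rw [hsq]
      · linear_combination (-p 0) * h
      · linear_combination (-p 1) * h
    · rintro ⟨t, rfl⟩
      simp [he]
      ring
  rw [hrange, ← hiso.map_hausdorffMeasure (Or.inl zero_le_one), hausdorffMeasure_real,
    hiso.isClosedEmbedding.measurableEmbedding.integral_map]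

theorem IsNorm.integral_inv_one_add_rpow_smul {N : ℕ} {𝒩 : EuclideanSpace ℝ (Fin N) → ℝ}
    (h𝒩 : IsNorm 𝒩) (s : ℝ) (x : EuclideanSpace ℝ (Fin N)) :
    ∫ t : ℝ, (1 + 𝒩 (t • x) ^ s)⁻¹ =
      (𝒩 x)⁻¹ * (2 * ∫ t in Ioi (0 : ℝ), (1 + t ^ s)⁻¹) := by
  have hc := h𝒩.1 x
  calc ∫ t : ℝ, (1 + 𝒩 (t • x) ^ s)⁻¹ = ∫ t : ℝ, (1 + |t * 𝒩 x| ^ s)⁻¹ := by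
        simp only [h𝒩.2.2.1, abs_mul, abs_of_nonneg hc]
    _ = _ := by
        rw [Measure.integral_comp_mul_right (fun t : ℝ => (1 + |t| ^ s)⁻¹),
          integral_comp_abs (f := fun t : ℝ => (1 + t ^ s)⁻¹), abs_of_nonneg (inv_nonneg.mpr hc),
          smul_eq_mul]

/-- In the plane, the mobility of `p` is a multiple of `𝒩` at the rotation of `p`
by a right angle. -/
theorem IsNorm.mobility_eq {𝒩 : EuclideanSpace ℝ (Fin 2) → ℝ} (h𝒩 : IsNorm 𝒩) (s : ℝ)
    (p : EuclideanSpace ℝ (Fin 2)) :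
    (if p = 0 then 0 else
        ‖p‖ * (2 * ∫ x in {x : EuclideanSpace ℝ (Fin 2) | ⟪x, p⟫ = 0},
            (1 + 𝒩 x ^ s)⁻¹ ∂μH[(1 : ℝ)])⁻¹) =
      (4 * ∫ t in Ioi (0 : ℝ), (1 + t ^ s)⁻¹)⁻¹ * 𝒩 !₂[-p 1, p 0] := by
  split_ifs with hp
  · have : (!₂[-p 1, p 0] : EuclideanSpace ℝ (Fin 2)) = 0 := by
      subst hp
      ext i
      fin_cases i <;> simp
    rw [this, (h𝒩.2.1 0).2 rfl, mul_zero]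
  · have hp' : ‖p‖ ≠ 0 := norm_ne_zero_iff.mpr hp
    rw [setIntegral_orthogonal_hausdorffMeasure (fun x => (1 + 𝒩 x ^ s)⁻¹) hp,
      h𝒩.integral_inv_one_add_rpow_smul, h𝒩.2.2.1, abs_of_nonneg (by positivity)]
    simp only [mul_inv, inv_inv]
    field_simp
    ring

/-- A sublevel set of the rotated and dilated norm determines the unit ball of `𝒩`. -/
theorem IsNorm.unitBall_eq_of_rotated {𝒩 : EuclideanSpace ℝ (Fin 2) → ℝ} (h𝒩 : IsNorm 𝒩)
    {c : ℝ} (hc : 0 < c) {P : EuclideanSpace ℝ (Fin 2) → Prop}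
    (h : ∀ p, c * 𝒩 !₂[-p 1, p 0] ≤ 1 ↔ P p) (x : EuclideanSpace ℝ (Fin 2)) :
    𝒩 x ≤ 1 ↔ P !₂[x 1 / c, -(x 0 / c)] := by
  rw [← h]
  have : (!₂[-(!₂[x 1 / c, -(x 0 / c)] : EuclideanSpace ℝ (Fin 2)) 1,
      (!₂[x 1 / c, -(x 0 / c)] : EuclideanSpace ℝ (Fin 2)) 0] : EuclideanSpace ℝ (Fin 2)) =
      c⁻¹ • x := by
    ext i
    fin_cases i <;> simp [div_eq_inv_mul]
  rw [this, h𝒩.2.2.1, abs_of_pos (inv_pos.mpr hc), mul_inv_cancel_left₀ hc.ne']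

/-- Recovering the unit ball of `𝒩` from the unit ball of the mobility `Φ_α` in
dimension `2`: if `{Φ_α ≤ 1}` is the ellipse with semi-axes `a, b`, then `{𝒩 ≤ 1}` is
the ellipse with semi-axes `λ_α b, λ_α a`, and if `{Φ_α ≤ 1}` is the `ℓ^q` unit ball,
then `{𝒩 ≤ 1}` is the `ℓ^q` ball of radius `λ_α`. -/
theorem stmt_10 (𝒩 : EuclideanSpace ℝ (Fin 2) → ℝ) (h𝒩 : IsNorm 𝒩)
    (α : ℝ) (hα1 : 0 < α) (hα2 : α < 2)
    (a b : ℝ) (ha : 0 < a) (hb : 0 < b) (q : ℝ≥0∞) (hq : 1 ≤ q) :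
    let Φ : EuclideanSpace ℝ (Fin 2) → ℝ := fun p =>
      if p = 0 then 0 else
        ‖p‖ * (2 * ∫ x in {x : EuclideanSpace ℝ (Fin 2) | ⟪x, p⟫ = 0},
            (1 + 𝒩 x ^ ((2:ℝ) + α))⁻¹ ∂μH[(1:ℝ)])⁻¹
    let lamα : ℝ := (4 * ∫ t in Ioi (0:ℝ), (1 + t ^ ((2:ℝ) + α))⁻¹)⁻¹
    let lq : EuclideanSpace ℝ (Fin 2) → ℝ := fun p =>
      if q = ∞ then max |p 0| |p 1|
      else (|p 0| ^ q.toReal + |p 1| ^ q.toReal) ^ (1 / q.toReal)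
    ({p | Φ p ≤ 1} = {p : EuclideanSpace ℝ (Fin 2) |
          (p 0) ^ 2 / a ^ 2 + (p 1) ^ 2 / b ^ 2 ≤ 1} →
        {p | 𝒩 p ≤ 1} = {p : EuclideanSpace ℝ (Fin 2) |
          (p 0) ^ 2 / b ^ 2 + (p 1) ^ 2 / a ^ 2 ≤ lamα ^ 2}) ∧
    ({p | Φ p ≤ 1} = {p | lq p ≤ 1} →
        {p | 𝒩 p ≤ 1} = {p | lq p ≤ lamα}) := by
  intro Φ lamα lq
  have hlam : 0 < lamα :=
    inv_pos.mpr (mul_pos four_pos (integral_Ioi_inv_one_add_rpow_pos (by linarith)))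
  have hΦ : ∀ p, Φ p = lamα * 𝒩 !₂[-p 1, p 0] := fun p => h𝒩.mobility_eq (2 + α) p
  refine ⟨fun h => ?_, fun h => ?_⟩
  · ext x
    simp only [Set.ext_iff, mem_ofPred_eq, hΦ] at h ⊢
    rw [h𝒩.unitBall_eq_of_rotated hlam h, ← div_le_one (pow_pos hlam 2)]
    refine iff_of_eq (congrArg (· ≤ (1 : ℝ)) ?_)
    simp
    field_simp
    ring
  · ext x
    simp only [Set.ext_iff, mem_ofPred_eq, hΦ] at h ⊢
    rw [h𝒩.unitBall_eq_of_rotated hlam h, ← div_le_one hlam]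
    refine iff_of_eq (congrArg (· ≤ (1 : ℝ)) ?_)
    by_cases hq' : q = ∞
    · simp only [lq, if_pos hq', Matrix.cons_val_zero, Matrix.cons_val_one,
        abs_neg, abs_div, abs_of_pos hlam]
      rw [max_div_div_right hlam.le, max_comm]
    · have hq0 : q.toReal ≠ 0 :=
        (ENNReal.toReal_pos (zero_lt_one.trans_le hq).ne' hq').ne'
      simp only [lq, if_neg hq', Matrix.cons_val_zero, Matrix.cons_val_one,
        abs_neg, abs_div, abs_of_pos hlam, Real.div_rpow (abs_nonneg _) hlam.le]
      rw [← add_div, Real.div_rpow (by positivity) (by positivity), one_div,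
        Real.rpow_rpow_inv hlam.le hq0, add_comm]
end
end

section
/- Let N ≥ 2, let 𝒩 be a norm on ℝ^N, α ∈ [1,2), g ∈ C([0,∞)), h > 0, and let Ω₀ ⊂ ℝ^N be an open convex set. Define recursively u_h(·,0) = 1_{Ω₀} − 1_{(closure Ω₀)^c} and, for n ∈ ℕ, Ω^h_{(n+1)h} = { x ∈ ℝ^N : (J_h * u_h(·,nh))(x) > −g(nh) · β(α,h) } and u_h(·,(n+1)h) = 1_{Ω^h_{(n+1)h}} − 1_{(Ω^h_{(n+1)h})^c}. Then for every n ∈ ℕ \ {0}, the set Ω^h_{nh} is convex. -/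
open MeasureTheory Metric Set Filter
open scoped RealInnerProductSpace Classical Topology

noncomputable section

lemma volume_add_volume_le_of_isCompact {K L W : Set ℝ} (hK : IsCompact K) (hL : IsCompact L)
    (hK0 : K.Nonempty) (hL0 : L.Nonempty) (h : ∀ x ∈ K, ∀ y ∈ L, x + y ∈ W) :
    volume K + volume L ≤ volume W := by
  obtain ⟨k, hk, hkmax⟩ := hK.exists_isGreatest hK0
  obtain ⟨l, hl, hlmin⟩ := hL.exists_isLeast hL0
  have hsub : (fun x => l + x) '' K ∪ (fun x => k + x) '' L ⊆ W := by
    rintro _ (⟨x, hx, rfl⟩ | ⟨y, hy, rfl⟩)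
    · simpa [add_comm] using h x hx l hl
    · exact h k hk y hy
  have hdisj : AEDisjoint volume ((fun x => l + x) '' K) ((fun x => k + x) '' L) := by
    refine measure_mono_null (t := {k + l}) ?_ (by simp)
    rintro _ ⟨⟨x, hx, rfl⟩, ⟨y, hy, hxy⟩⟩
    have h1 := hkmax hx
    have h2 := hlmin hy
    simp only [mem_singleton_iff] at *
    linarith
  have hL' : MeasurableSet ((fun x => k + x) '' L) :=
    (hL.image (by fun_prop)).measurableSet
  calc volume K + volume L
      = volume ((fun x => l + x) '' K) + volume ((fun x => k + x) '' L) := by simp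
    _ = volume ((fun x => l + x) '' K ∪ (fun x => k + x) '' L) :=
        (measure_union₀ hL'.nullMeasurableSet hdisj).symm
    _ ≤ volume W := measure_mono hsub

lemma mul_volume_add_le_of_forall_isCompact {S : Set ℝ} (hS : MeasurableSet S) (hS0 : S.Nonempty)
    {A c w : ENNReal}
    (h : ∀ K ⊆ S, IsCompact K → K.Nonempty → A * volume K + c ≤ w) :
    A * volume S + c ≤ w := by
  let ι := {K : Set ℝ // K ⊆ S ∧ IsCompact K ∧ K.Nonempty}
  obtain ⟨x, hx⟩ := hS0
  have : Nonempty ι := ⟨⟨{x}, by simpa using hx, isCompact_singleton, by simp⟩⟩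
  have hle : volume S ≤ ⨆ K : ι, volume K.1 := by
    rw [hS.measure_eq_iSup_isCompact]
    refine iSup₂_le fun K hK => iSup_le fun hKc => ?_
    rcases K.eq_empty_or_nonempty with rfl | hK0
    · simp
    · exact le_iSup (fun K : ι => volume K.1) ⟨K, hK, hKc, hK0⟩
  calc A * volume S + c ≤ A * (⨆ K : ι, volume K.1) + c := by gcongr
    _ ≤ w := by
      rw [ENNReal.mul_iSup, ENNReal.iSup_add]
      exact iSup_le fun K => h K.1 K.2.1 K.2.2.1 K.2.2.2

/-- One-dimensional Brunn-Minkowski inequality. -/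
lemma mul_volume_add_mul_volume_le {S T W : Set ℝ} (hS : MeasurableSet S) (hT : MeasurableSet T)
    (hS0 : S.Nonempty) (hT0 : T.Nonempty) {a b : ℝ} (ha : 0 ≤ a) (hb : 0 ≤ b)
    (h : ∀ x ∈ S, ∀ y ∈ T, a * x + b * y ∈ W) :
    ENNReal.ofReal a * volume S + ENNReal.ofReal b * volume T ≤ volume W := by
  refine mul_volume_add_le_of_forall_isCompact hS hS0 fun K hKS hK hK0 => ?_
  rw [add_comm]
  refine mul_volume_add_le_of_forall_isCompact hT hT0 fun L hLT hL hL0 => ?_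
  have key := volume_add_volume_le_of_isCompact (hK.smul a) (hL.smul b) hK0.smul_set hL0.smul_set
    (W := W) (by
      rintro _ ⟨x, hx, rfl⟩ _ ⟨y, hy, rfl⟩
      exact h x (hKS hx) y (hLT hy))
  rw [Measure.addHaar_smul, Measure.addHaar_smul] at key
  simpa [abs_of_nonneg ha, abs_of_nonneg hb, add_comm] using key

lemma lintegral_eq_lintegral_volume_lt {φ : ℝ → ENNReal} (hφ : Measurable φ) (h1 : ∀ x, φ x ≤ 1) :
    ∫⁻ x, φ x = ∫⁻ t in Ioi (0 : ℝ), volume {x | ENNReal.ofReal t < φ x} := by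
  have hfin : ∀ x, φ x ≠ ⊤ := fun x => ((h1 x).trans_lt ENNReal.one_lt_top).ne
  have := lintegral_eq_lintegral_meas_lt (volume : Measure ℝ) (f := fun x => (φ x).toReal)
    (Eventually.of_forall fun x => ENNReal.toReal_nonneg) hφ.ennreal_toReal.aemeasurable
  simp only [ENNReal.ofReal_toReal (hfin _)] at this
  rw [this]
  refine setLIntegral_congr_fun measurableSet_Ioi fun t ht => ?_
  simp only [ENNReal.ofReal_lt_iff_lt_toReal (le_of_lt ht) (hfin _)]

/-- One-dimensional Prékopa-Leindler type inequality for functions of supremum one. -/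
lemma mul_lintegral_add_mul_lintegral_le {φ ψ χ : ℝ → ENNReal} (hφ : Measurable φ)
    (hψ : Measurable ψ) (hχ : Measurable χ) (hφ1 : ⨆ x, φ x = 1) (hψ1 : ⨆ x, ψ x = 1)
    {a b : ℝ} (ha : 0 ≤ a) (hb : 0 ≤ b) (h : ∀ x y, min (φ x) (ψ y) ≤ χ (a * x + b * y)) :
    ENNReal.ofReal a * (∫⁻ x, φ x) + ENNReal.ofReal b * (∫⁻ x, ψ x) ≤ ∫⁻ x, χ x := by
  have hφle : ∀ x, φ x ≤ 1 := fun x => hφ1 ▸ le_iSup φ x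
  have hψle : ∀ x, ψ x ≤ 1 := fun x => hψ1 ▸ le_iSup ψ x
  have hmeas : ∀ f : ℝ → ENNReal, Measurable fun t : ℝ => volume {x | ENNReal.ofReal t < f x} := by
    intro f
    refine Antitone.measurable fun s t hst => measure_mono fun x hx => ?_
    exact (ENNReal.ofReal_le_ofReal hst).trans_lt hx
  calc ENNReal.ofReal a * (∫⁻ x, φ x) + ENNReal.ofReal b * (∫⁻ x, ψ x)
      = ∫⁻ t in Ioi (0 : ℝ), (ENNReal.ofReal a * volume {x | ENNReal.ofReal t < φ x} +
          ENNReal.ofReal b * volume {x | ENNReal.ofReal t < ψ x}) := by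
        rw [lintegral_eq_lintegral_volume_lt hφ hφle, lintegral_eq_lintegral_volume_lt hψ hψle,
          lintegral_add_left ((hmeas φ).const_mul _), lintegral_const_mul _ (hmeas φ),
          lintegral_const_mul _ (hmeas ψ)]
    _ ≤ ∫⁻ t in Ioi (0 : ℝ), volume {x | ENNReal.ofReal t < min (χ x) 1} := by
        refine lintegral_mono fun t => ?_
        rcases lt_or_ge (ENNReal.ofReal t) 1 with ht | ht
        · refine mul_volume_add_mul_volume_le (measurableSet_lt measurable_const hφ)
            (measurableSet_lt measurable_const hψ) (lt_iSup_iff.1 (ht.trans_eq hφ1.symm))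
            (lt_iSup_iff.1 (ht.trans_eq hψ1.symm)) ha hb fun x hx y hy => ?_
          exact lt_min ((lt_min hx hy).trans_le (h x y)) ht
        · have h1 : {x | ENNReal.ofReal t < φ x} = ∅ :=
            eq_empty_of_forall_notMem fun x hx => (hx.trans_le (hφle x)).not_ge ht
          have h2 : {x | ENNReal.ofReal t < ψ x} = ∅ :=
            eq_empty_of_forall_notMem fun x hx => (hx.trans_le (hψle x)).not_ge ht
          simp [h1, h2]
    _ = ∫⁻ x, min (χ x) 1 :=
        (lintegral_eq_lintegral_volume_lt (hχ.min measurable_const) fun x => min_le_right _ _).symm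
    _ ≤ ∫⁻ x, χ x := lintegral_mono fun x => min_le_left _ _

/-- The weighted power mean of exponent `-1/q`. -/
def negPowerMean (a b q : ℝ) (x y : ENNReal) : ENNReal :=
  (ENNReal.ofReal a * x ^ (-q⁻¹) + ENNReal.ofReal b * y ^ (-q⁻¹)) ^ (-q)

lemma negPowerMean_mono {a b q : ℝ} (hq : 0 < q) {x x' y y' : ENNReal} (hx : x ≤ x')
    (hy : y ≤ y') : negPowerMean a b q x y ≤ negPowerMean a b q x' y' := by
  have hqi : 0 < q⁻¹ := inv_pos.2 hq
  simp only [negPowerMean, ENNReal.rpow_neg]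
  gcongr

lemma negPowerMean_comm (a b q : ℝ) (x y : ENNReal) :
    negPowerMean a b q x y = negPowerMean b a q y x := by
  simp only [negPowerMean, add_comm]

lemma negPowerMean_zero_left {a b q : ℝ} (ha : 0 < a) (hq : 0 < q) (y : ENNReal) :
    negPowerMean a b q 0 y = 0 := by
  simp [negPowerMean, ENNReal.zero_rpow_of_neg, ENNReal.mul_top, ENNReal.top_rpow_of_neg, hq, ha]

lemma negPowerMean_zero_right {a b q : ℝ} (hb : 0 < b) (hq : 0 < q) (x : ENNReal) :
    negPowerMean a b q x 0 = 0 := by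
  rw [negPowerMean_comm, negPowerMean_zero_left hb hq]

lemma negPowerMean_self {a b q : ℝ} (ha : 0 ≤ a) (hb : 0 ≤ b) (hab : a + b = 1) (hq : 0 < q)
    (x : ENNReal) : negPowerMean a b q x x = x := by
  rw [negPowerMean, ← add_mul, ← ENNReal.ofReal_add ha hb, hab, ENNReal.ofReal_one, one_mul,
    ← ENNReal.rpow_mul]
  simp [hq.ne']

lemma min_le_negPowerMean {a b q : ℝ} (ha : 0 ≤ a) (hb : 0 ≤ b) (hab : a + b = 1) (hq : 0 < q)
    (x y : ENNReal) : min x y ≤ negPowerMean a b q x y := by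
  calc min x y = negPowerMean a b q (min x y) (min x y) := (negPowerMean_self ha hb hab hq _).symm
    _ ≤ _ := negPowerMean_mono hq (min_le_left _ _) (min_le_right _ _)

lemma negPowerMean_mul (a b : ℝ) {q : ℝ} (hq : 0 < q) {c : ENNReal} (hc0 : c ≠ 0) (hc : c ≠ ⊤)
    (x y : ENNReal) : negPowerMean a b q (c * x) (c * y) = c * negPowerMean a b q x y := by
  have hc1 : c ^ (-q⁻¹) ≠ 0 := by simp [ENNReal.rpow_eq_zero_iff, hc0, hc]
  have hc2 : c ^ (-q⁻¹) ≠ ⊤ := by simp [ENNReal.rpow_eq_top_iff, hc0, hc]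
  have hmul : ∀ z : ENNReal, ∀ r : ℝ, ∀ d : ENNReal, d ≠ 0 → d ≠ ⊤ →
      (d * z) ^ r = d ^ r * z ^ r := by
    intro z r d hd0 hd
    rw [ENNReal.mul_rpow_eq_ite]
    simp [hd0, hd]
  rw [negPowerMean, hmul _ _ c hc0 hc, hmul _ _ c hc0 hc]
  rw [show ENNReal.ofReal a * (c ^ (-q⁻¹) * x ^ (-q⁻¹)) + ENNReal.ofReal b * (c ^ (-q⁻¹) * y ^ (-q⁻¹))
    = c ^ (-q⁻¹) * (ENNReal.ofReal a * x ^ (-q⁻¹) + ENNReal.ofReal b * y ^ (-q⁻¹)) by ring,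
    hmul _ _ _ hc1 hc2, ← ENNReal.rpow_mul]
  simp [hq.ne', negPowerMean]

lemma tendsto_negPowerMean {a b q : ℝ} {u v : ℕ → ENNReal} {x y : ENNReal}
    (hu : Tendsto u atTop (𝓝 x)) (hv : Tendsto v atTop (𝓝 y)) :
    Tendsto (fun n => negPowerMean a b q (u n) (v n)) atTop (𝓝 (negPowerMean a b q x y)) := by
  have h1 := ENNReal.Tendsto.const_mul (a := ENNReal.ofReal a)
    ((ENNReal.continuous_rpow_const (y := -q⁻¹)).tendsto x |>.comp hu) (.inr ENNReal.ofReal_ne_top)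
  have h2 := ENNReal.Tendsto.const_mul (a := ENNReal.ofReal b)
    ((ENNReal.continuous_rpow_const (y := -q⁻¹)).tendsto y |>.comp hv) (.inr ENNReal.ofReal_ne_top)
  exact ((ENNReal.continuous_rpow_const (y := -q)).tendsto _).comp (h1.add h2)

lemma negPowerMean_ofReal {a b q x y : ℝ} (ha : 0 < a) (hb : 0 < b) (hx : 0 < x) (hy : 0 < y) :
    negPowerMean a b q (ENNReal.ofReal x) (ENNReal.ofReal y) =
      ENNReal.ofReal ((a * x ^ (-q⁻¹) + b * y ^ (-q⁻¹)) ^ (-q)) := by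
  have h1 : 0 < x ^ (-q⁻¹) := Real.rpow_pos_of_pos hx _
  have h2 : 0 < y ^ (-q⁻¹) := Real.rpow_pos_of_pos hy _
  rw [negPowerMean, ENNReal.ofReal_rpow_of_pos hx, ENNReal.ofReal_rpow_of_pos hy,
    ← ENNReal.ofReal_mul ha.le, ← ENNReal.ofReal_mul hb.le,
    ← ENNReal.ofReal_add (by positivity) (by positivity), ENNReal.ofReal_rpow_of_pos (by positivity)]

lemma rpow_add_mul_rpow_le {a b q F G c d : ℝ} (ha : 0 < a) (hb : 0 < b) (hq : 0 < q)
    (hF : 0 < F) (hG : 0 < G) (hc : 0 < c) (hd : 0 < d) :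
    (a * (F * c) ^ (-q⁻¹) + b * (G * d) ^ (-q⁻¹)) ^ (-q) ≤
      (a * F ^ (-(q + 1)⁻¹) + b * G ^ (-(q + 1)⁻¹)) ^ (-(q + 1)) * (a * c + b * d) := by
  have hq1 : 0 < q + 1 := by linarith
  have hpq : (q + 1).HolderConjugate ((q + 1) / q) := by
    rw [Real.holderConjugate_iff]
    refine ⟨by linarith, ?_⟩
    field_simp
    ring
  have key := Real.inner_le_Lp_mul_Lq_of_nonneg Finset.univ
    (f := ![(a * c) ^ (q + 1)⁻¹, (b * d) ^ (q + 1)⁻¹])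
    (g := ![a ^ (q / (q + 1)) * (F * c) ^ (-(q + 1)⁻¹), b ^ (q / (q + 1)) * (G * d) ^ (-(q + 1)⁻¹)])
    hpq (by intro i _; fin_cases i <;> simp <;> positivity)
    (by intro i _; fin_cases i <;> simp <;> positivity)
  have e1 : ∀ {a c F : ℝ}, 0 < a → 0 < c → 0 < F →
      (a * c) ^ (q + 1)⁻¹ * (a ^ (q / (q + 1)) * (F * c) ^ (-(q + 1)⁻¹)) =
        a * F ^ (-(q + 1)⁻¹) := by
    intro a c F ha hc hF
    rw [Real.mul_rpow ha.le hc.le, Real.mul_rpow hF.le hc.le, Real.rpow_neg hc.le]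
    have : a ^ (q + 1)⁻¹ * a ^ (q / (q + 1)) = a := by
      rw [← Real.rpow_add ha]
      convert Real.rpow_one a using 2
      field_simp
      ring
    have hc' : c ^ (q + 1)⁻¹ ≠ 0 := (Real.rpow_pos_of_pos hc _).ne'
    calc _ = (a ^ (q + 1)⁻¹ * a ^ (q / (q + 1))) * F ^ (-(q + 1)⁻¹) *
          (c ^ (q + 1)⁻¹ * (c ^ (q + 1)⁻¹)⁻¹) := by ring
      _ = _ := by rw [this, mul_inv_cancel₀ hc', mul_one]
  have e2 : ∀ {x : ℝ}, 0 < x → (x ^ (q + 1)⁻¹) ^ (q + 1) = x := by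
    intro x hx
    rw [← Real.rpow_mul hx.le, inv_mul_cancel₀ hq1.ne', Real.rpow_one]
  have e3 : ∀ {a z : ℝ}, 0 < a → 0 < z →
      (a ^ (q / (q + 1)) * z ^ (-(q + 1)⁻¹)) ^ ((q + 1) / q) = a * z ^ (-q⁻¹) := by
    intro a z ha hz
    rw [Real.mul_rpow (by positivity) (by positivity), ← Real.rpow_mul ha.le, ← Real.rpow_mul hz.le]
    congr 1
    · convert Real.rpow_one a using 2
      field_simp
    · congr 1
      field_simp
  simp only [Fin.sum_univ_two, Matrix.cons_val_zero, Matrix.cons_val_one] at key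
  rw [e1 ha hc hF, e1 hb hd hG, e2 (by positivity), e2 (by positivity), e3 ha (by positivity),
    e3 hb (by positivity)] at key
  set P := a * F ^ (-(q + 1)⁻¹) + b * G ^ (-(q + 1)⁻¹) with hP
  set S := a * (F * c) ^ (-q⁻¹) + b * (G * d) ^ (-q⁻¹) with hS
  set C := a * c + b * d with hC
  have hP0 : 0 < P := by positivity
  have hS0 : 0 < S := by positivity
  have hC0 : 0 < C := by positivity
  have key2 : P ^ (q + 1) ≤ C * S ^ q := by
    calc P ^ (q + 1) ≤ (C ^ (1 / (q + 1)) * S ^ (1 / ((q + 1) / q))) ^ (q + 1) :=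
          Real.rpow_le_rpow hP0.le key hq1.le
      _ = C * S ^ q := by
        rw [Real.mul_rpow (by positivity) (by positivity), ← Real.rpow_mul hC0.le,
          ← Real.rpow_mul hS0.le]
        congr 1
        · rw [one_div_mul_cancel hq1.ne', Real.rpow_one]
        · congr 1
          field_simp
  rw [Real.rpow_neg hS0.le, Real.rpow_neg hP0.le, inv_mul_eq_div, inv_eq_one_div,
    div_le_div_iff₀ (by positivity) (by positivity)]
  linarith

lemma negPowerMean_ne_zero {a b q : ℝ} (hq : 0 < q) {x y : ENNReal} (hx : x ≠ 0) (hy : y ≠ 0) :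
    negPowerMean a b q x y ≠ 0 := by
  simp only [negPowerMean, Ne, ENNReal.rpow_eq_zero_iff]
  have h1 : ENNReal.ofReal a * x ^ (-q⁻¹) ≠ ⊤ :=
    ENNReal.mul_ne_top ENNReal.ofReal_ne_top (by simp [ENNReal.rpow_eq_top_iff, hx, hq.le])
  have h2 : ENNReal.ofReal b * y ^ (-q⁻¹) ≠ ⊤ :=
    ENNReal.mul_ne_top ENNReal.ofReal_ne_top (by simp [ENNReal.rpow_eq_top_iff, hy, hq.le])
  rintro (⟨-, h⟩ | ⟨h, -⟩)
  · linarith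
  · exact (ENNReal.add_ne_top.2 ⟨h1, h2⟩) h

/-- Hölder's inequality for power means. -/
lemma negPowerMean_mul_le {a b q : ℝ} (ha : 0 < a) (hb : 0 < b) (hq : 0 < q)
    {F G c d : ENNReal} (hF0 : F ≠ 0) (hF : F ≠ ⊤) (hG0 : G ≠ 0) (hG : G ≠ ⊤) :
    negPowerMean a b q (F * c) (G * d) ≤
      negPowerMean a b (q + 1) F G * (ENNReal.ofReal a * c + ENNReal.ofReal b * d) := by
  rcases eq_or_ne c 0 with rfl | hc0
  · simp [negPowerMean_zero_left ha hq]
  rcases eq_or_ne d 0 with rfl | hd0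
  · simp [negPowerMean_zero_right hb hq]
  have hM := negPowerMean_ne_zero (a := a) (b := b) (by linarith : 0 < q + 1) hF0 hG0
  rcases eq_or_ne c ⊤ with rfl | hc
  · simp [ENNReal.mul_top, ha, hM]
  rcases eq_or_ne d ⊤ with rfl | hd
  · simp [ENNReal.mul_top, hb, hM]
  have hpos : ∀ {x : ENNReal}, x ≠ 0 → x ≠ ⊤ → 0 < x.toReal := fun h h' => ENNReal.toReal_pos h h'
  have := rpow_add_mul_rpow_le ha hb hq (hpos hF0 hF) (hpos hG0 hG) (hpos hc0 hc) (hpos hd0 hd)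
  rw [← ENNReal.ofReal_toReal hF, ← ENNReal.ofReal_toReal hG, ← ENNReal.ofReal_toReal hc,
    ← ENNReal.ofReal_toReal hd]
  have h1 := hpos hF0 hF
  have h2 := hpos hG0 hG
  have h3 := hpos hc0 hc
  have h4 := hpos hd0 hd
  rw [← ENNReal.ofReal_mul h1.le, ← ENNReal.ofReal_mul h2.le, ← ENNReal.ofReal_mul ha.le,
    ← ENNReal.ofReal_mul hb.le, ← ENNReal.ofReal_add (by positivity) (by positivity),
    negPowerMean_ofReal ha hb (by positivity) (by positivity), negPowerMean_ofReal ha hb h1 h2,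
    ← ENNReal.ofReal_mul (by positivity)]
  exact ENNReal.ofReal_le_ofReal this

lemma negPowerMean_lintegral_le_of_iSup_ne_top {a b q : ℝ} (ha : 0 < a) (hb : 0 < b)
    (hab : a + b = 1) (hq : 0 < q) {f g k : ℝ → ENNReal} (hf : Measurable f) (hg : Measurable g)
    (hk : Measurable k) (hfb : ⨆ x, f x ≠ ⊤) (hgb : ⨆ x, g x ≠ ⊤)
    (h : ∀ x y, negPowerMean a b (q + 1) (f x) (g y) ≤ k (a * x + b * y)) :
    negPowerMean a b q (∫⁻ x, f x) (∫⁻ x, g x) ≤ ∫⁻ x, k x := by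
  have hq1 : 0 < q + 1 := by linarith
  set F := ⨆ x, f x with hF
  set G := ⨆ x, g x with hG
  rcases eq_or_ne F 0 with hF0 | hF0
  · have : ∀ x, f x = 0 := fun x => le_antisymm (hF0 ▸ le_iSup f x) zero_le
    simp [this, negPowerMean_zero_left ha hq]
  rcases eq_or_ne G 0 with hG0 | hG0
  · have : ∀ x, g x = 0 := fun x => le_antisymm (hG0 ▸ le_iSup g x) zero_le
    simp [this, negPowerMean_zero_right hb hq]
  have hmul : ∀ {C : ENNReal}, C ≠ 0 → C ≠ ⊤ → ∀ z, C * (C⁻¹ * z) = z := by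
    intro C h0 h1 z
    rw [← mul_assoc, ENNReal.mul_inv_cancel h0 h1, one_mul]
  set M := negPowerMean a b (q + 1) F G with hM
  have hM0 : M ≠ 0 := negPowerMean_ne_zero hq1 hF0 hG0
  have hMtop : M ≠ ⊤ := by
    rw [hM, ← ENNReal.ofReal_toReal hfb, ← ENNReal.ofReal_toReal hgb,
      negPowerMean_ofReal ha hb (ENNReal.toReal_pos hF0 hfb) (ENNReal.toReal_pos hG0 hgb)]
    exact ENNReal.ofReal_ne_top
  have key := mul_lintegral_add_mul_lintegral_le (φ := fun x => F⁻¹ * f x)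
    (ψ := fun x => G⁻¹ * g x) (χ := fun x => M⁻¹ * k x) (hf.const_mul _) (hg.const_mul _)
    (hk.const_mul _) (by rw [← ENNReal.mul_iSup, ENNReal.inv_mul_cancel hF0 hfb])
    (by rw [← ENNReal.mul_iSup, ENNReal.inv_mul_cancel hG0 hgb]) ha.le hb.le (by
      intro x y
      set t := min (F⁻¹ * f x) (G⁻¹ * g y) with ht
      have htF : t * F ≤ f x := by
        calc t * F ≤ (F⁻¹ * f x) * F := by gcongr; exact min_le_left _ _
          _ = f x := by rw [mul_comm, hmul hF0 hfb]
      have htG : t * G ≤ g y := by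
        calc t * G ≤ (G⁻¹ * g y) * G := by gcongr; exact min_le_right _ _
          _ = g y := by rw [mul_comm, hmul hG0 hgb]
      have hle := (negPowerMean_mono (a := a) (b := b) hq1 htF htG).trans (h x y)
      rcases eq_or_ne t 0 with ht0 | ht0
      · simp [ht0]
      have htt : t ≠ ⊤ := by
        refine ((min_le_left (F⁻¹ * f x) (G⁻¹ * g y)).trans_lt ?_).ne
        exact ENNReal.mul_lt_top (by simpa [pos_iff_ne_zero] using hF0)
          ((le_iSup f x).trans_lt hfb.lt_top)
      rw [negPowerMean_mul a b hq1 ht0 htt, ← hM] at hle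
      calc t = M⁻¹ * (t * M) := by
            rw [mul_comm t, ← mul_assoc, ENNReal.inv_mul_cancel hM0 hMtop, one_mul]
        _ ≤ _ := by gcongr)
  rw [lintegral_const_mul _ hf, lintegral_const_mul _ hg, lintegral_const_mul _ hk] at key
  calc negPowerMean a b q (∫⁻ x, f x) (∫⁻ x, g x)
      = negPowerMean a b q (F * (F⁻¹ * ∫⁻ x, f x)) (G * (G⁻¹ * ∫⁻ x, g x)) := by
        rw [hmul hF0 hfb, hmul hG0 hgb]
    _ ≤ M * (ENNReal.ofReal a * (F⁻¹ * ∫⁻ x, f x) + ENNReal.ofReal b * (G⁻¹ * ∫⁻ x, g x)) :=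
        negPowerMean_mul_le ha hb hq hF0 hfb hG0 hgb
    _ ≤ M * (M⁻¹ * ∫⁻ x, k x) := by gcongr
    _ = ∫⁻ x, k x := hmul hM0 hMtop _

/-- One-dimensional Borell-Brascamp-Lieb inequality. -/
lemma negPowerMean_lintegral_le_real {a b q : ℝ} (ha : 0 < a) (hb : 0 < b)
    (hab : a + b = 1) (hq : 0 < q) {f g k : ℝ → ENNReal} (hf : Measurable f) (hg : Measurable g)
    (hk : Measurable k)
    (h : ∀ x y, negPowerMean a b (q + 1) (f x) (g y) ≤ k (a * x + b * y)) :
    negPowerMean a b q (∫⁻ x, f x) (∫⁻ x, g x) ≤ ∫⁻ x, k x := by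
  have hq1 : 0 < q + 1 := by linarith
  have htrunc : ∀ {f : ℝ → ENNReal}, Measurable f →
      Tendsto (fun n : ℕ => ∫⁻ x, min (f x) n) atTop (𝓝 (∫⁻ x, f x)) := by
    intro f hf
    refine lintegral_tendsto_of_tendsto_of_monotone
      (fun n => (hf.min measurable_const).aemeasurable)
      (Eventually.of_forall fun x m n hmn => min_le_min_left _ (by exact_mod_cast hmn))
      (Eventually.of_forall fun x => ?_)
    have := (tendsto_const_nhds (x := f x)).min ENNReal.tendsto_nat_nhds_top
    simpa using this
  have hb' : ∀ (f : ℝ → ENNReal) (n : ℕ), ⨆ x, min (f x) (n : ENNReal) ≠ ⊤ := fun f n =>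
    ((iSup_le fun x => min_le_right _ _).trans_lt (ENNReal.natCast_lt_top n)).ne
  refine le_of_tendsto' (tendsto_negPowerMean (htrunc hf) (htrunc hg)) fun n => ?_
  exact negPowerMean_lintegral_le_of_iSup_ne_top ha hb hab hq (hf.min measurable_const)
    (hg.min measurable_const) hk (hb' f n) (hb' g n) fun x y =>
      (negPowerMean_mono hq1 (min_le_left _ _) (min_le_left _ _)).trans (h x y)

lemma piFinSuccAbove_symm_zero {n : ℕ} (p : ℝ × (Fin n → ℝ)) :
    (MeasurableEquiv.piFinSuccAbove (fun _ : Fin (n + 1) => ℝ) 0).symm p = Fin.cons p.1 p.2 := by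
  ext i
  refine Fin.cases ?_ (fun j => ?_) i <;> simp [MeasurableEquiv.piFinSuccAbove]

lemma lintegral_pi_succ {n : ℕ} {f : (Fin (n + 1) → ℝ) → ENNReal} (hf : Measurable f) :
    ∫⁻ x, f x = ∫⁻ t : ℝ, ∫⁻ y : Fin n → ℝ, f (Fin.cons t y) := by
  have hmp := (volume_preserving_piFinSuccAbove (fun _ : Fin (n + 1) => ℝ) 0).symm
  rw [← hmp.lintegral_comp hf]
  have : Measurable fun p : ℝ × (Fin n → ℝ) =>
      f ((MeasurableEquiv.piFinSuccAbove (fun _ : Fin (n + 1) => ℝ) 0).symm p) :=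
    hf.comp (MeasurableEquiv.measurable _)
  rw [Measure.volume_eq_prod, lintegral_prod _ this.aemeasurable]
  simp only [piFinSuccAbove_symm_zero]

/-- **Borell-Brascamp-Lieb inequality** for power means of exponent `-1 / (q + n)`. -/
theorem negPowerMean_lintegral_le {a b : ℝ} (ha : 0 < a) (hb : 0 < b) (hab : a + b = 1) (n : ℕ) :
    ∀ {q : ℝ}, 0 < q → ∀ {f g k : (Fin n → ℝ) → ENNReal}, Measurable f → Measurable g →
      Measurable k →
      (∀ x y, negPowerMean a b (q + n) (f x) (g y) ≤ k (a • x + b • y)) →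
      negPowerMean a b q (∫⁻ x, f x) (∫⁻ x, g x) ≤ ∫⁻ x, k x := by
  induction n with
  | zero =>
    intro q hq f g k hf hg hk h
    have := h default default
    simp only [Nat.cast_zero, add_zero] at this
    rw [Measure.volume_pi_eq_dirac default]
    simp only [lintegral_dirac]
    convert this using 2
  | succ n ih =>
    intro q hq f g k hf hg hk h
    have hcons : Measurable fun p : ℝ × (Fin n → ℝ) => (Fin.cons p.1 p.2 : Fin (n + 1) → ℝ) := by
      have := (MeasurableEquiv.piFinSuccAbove (fun _ : Fin (n + 1) => ℝ) 0).symm.measurable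
      rwa [show ⇑(MeasurableEquiv.piFinSuccAbove (fun _ : Fin (n + 1) => ℝ) 0).symm =
        fun p => Fin.cons p.1 p.2 from funext piFinSuccAbove_symm_zero] at this
    have hsec : ∀ {f : (Fin (n + 1) → ℝ) → ENNReal}, Measurable f → ∀ t : ℝ,
        Measurable fun y : Fin n → ℝ => f (Fin.cons t y) := fun hf t =>
      hf.comp (hcons.comp measurable_prodMk_left)
    have hmarg : ∀ {f : (Fin (n + 1) → ℝ) → ENNReal}, Measurable f →
        Measurable fun t : ℝ => ∫⁻ y : Fin n → ℝ, f (Fin.cons t y) := fun hf =>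
      (hf.comp hcons).lintegral_prod_right'
    rw [lintegral_pi_succ hf, lintegral_pi_succ hg, lintegral_pi_succ hk]
    refine negPowerMean_lintegral_le_real ha hb hab hq (hmarg hf) (hmarg hg) (hmarg hk)
      fun s t => ?_
    refine ih (by linarith) (hsec hf s) (hsec hg t) (hsec hk _) fun x y => ?_
    have := h (Fin.cons s x) (Fin.cons t y)
    convert this using 2
    · push_cast; ring
    · ext i
      refine Fin.cases ?_ (fun j => ?_) i <;> simp

/-- Integration over a full Euclidean space of functions satisfying a concavity inequality for
power means of exponent greater than `-1 / N` preserves quasiconcavity. -/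
lemma min_lintegral_le {N : ℕ} {a b p : ℝ} (ha : 0 < a) (hb : 0 < b) (hab : a + b = 1)
    (hp : N < p) {f g k : EuclideanSpace ℝ (Fin N) → ENNReal} (hf : Measurable f)
    (hg : Measurable g) (hk : Measurable k)
    (h : ∀ x y, negPowerMean a b p (f x) (g y) ≤ k (a • x + b • y)) :
    min (∫⁻ x, f x) (∫⁻ x, g x) ≤ ∫⁻ x, k x := by
  have hq : 0 < p - N := by linarith
  have hmp := PiLp.volume_preserving_toLp (Fin N)
  rw [← hmp.lintegral_comp hf, ← hmp.lintegral_comp hg, ← hmp.lintegral_comp hk]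
  refine (min_le_negPowerMean ha.le hb.le hab hq _ _).trans ?_
  refine negPowerMean_lintegral_le ha hb hab N hq (hf.comp hmp.measurable)
    (hg.comp hmp.measurable) (hk.comp hmp.measurable) fun x y => ?_
  rw [sub_add_cancel]
  exact h _ _

lemma kernel_profile_concave {a b p s σ u v w : ℝ} (ha : 0 < a) (hb : 0 < b) (hab : a + b = 1)
    (hp : 1 ≤ p) (hs : 0 < s) (hσ : 0 < σ) (hu : 0 ≤ u) (hv : 0 ≤ v) (hw : 0 ≤ w)
    (hwuv : w ≤ a * u + b * v) :
    (a * (σ / (s + u ^ p)) ^ (-p⁻¹) + b * (σ / (s + v ^ p)) ^ (-p⁻¹)) ^ (-p) ≤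
      σ / (s + w ^ p) := by
  have hp0 : 0 < p := by linarith
  have hup : 0 < s + u ^ p := by positivity
  have hvp : 0 < s + v ^ p := by positivity
  have hwp : 0 < s + w ^ p := by positivity
  have e : ∀ {z : ℝ}, 0 < z → (σ / z) ^ (-p⁻¹) = z ^ p⁻¹ * σ ^ (-p⁻¹) := by
    intro z hz
    rw [Real.div_rpow hσ.le hz.le, Real.rpow_neg hz.le, div_inv_eq_mul, mul_comm]
  have hroot : ∀ {z : ℝ}, 0 ≤ z → (z ^ p⁻¹) ^ p = z := fun hz => by
    rw [← Real.rpow_mul hz, inv_mul_cancel₀ hp0.ne', Real.rpow_one]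
  have hscale : ∀ {c z : ℝ}, 0 < c → 0 ≤ z →
      ((c * s ^ p⁻¹) ^ p + (c * z) ^ p) ^ p⁻¹ = c * (s + z ^ p) ^ p⁻¹ := by
    intro c z hc hz
    rw [Real.mul_rpow hc.le (by positivity), Real.mul_rpow hc.le hz, hroot hs.le, ← mul_add,
      Real.mul_rpow (by positivity) (by positivity), ← Real.rpow_mul hc.le,
      mul_inv_cancel₀ hp0.ne', Real.rpow_one]
  have key := Real.Lp_add_le_of_nonneg (s := Finset.univ) (p := p)
    (f := ![a * s ^ p⁻¹, a * u]) (g := ![b * s ^ p⁻¹, b * v]) hp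
    (by intro i _; fin_cases i <;> simp <;> positivity)
    (by intro i _; fin_cases i <;> simp <;> positivity)
  simp only [Fin.sum_univ_two, Matrix.cons_val_zero, Matrix.cons_val_one, one_div] at key
  rw [hscale ha hu, hscale hb hv, ← add_mul, hab, one_mul, hroot hs.le] at key
  have key2 : s + w ^ p ≤ (a * (s + u ^ p) ^ p⁻¹ + b * (s + v ^ p) ^ p⁻¹) ^ p := by
    calc s + w ^ p ≤ s + (a * u + b * v) ^ p := by gcongr
      _ = ((s + (a * u + b * v) ^ p) ^ p⁻¹) ^ p := (hroot (by positivity)).symm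
      _ ≤ _ := by gcongr
  rw [e hup, e hvp, ← mul_assoc, ← mul_assoc, ← add_mul, Real.mul_rpow (by positivity)
    (by positivity), ← Real.rpow_mul hσ.le, neg_mul_neg, inv_mul_cancel₀ hp0.ne', Real.rpow_one,
    Real.rpow_neg (by positivity), inv_mul_eq_div]
  gcongr

namespace IsNorm

variable {N : ℕ} {𝒩 : EuclideanSpace ℝ (Fin N) → ℝ}

lemma smul_add_smul_le (h : IsNorm 𝒩) {a b : ℝ} (ha : 0 ≤ a) (hb : 0 ≤ b)
    (x y : EuclideanSpace ℝ (Fin N)) : 𝒩 (a • x + b • y) ≤ a * 𝒩 x + b * 𝒩 y := by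
  obtain ⟨-, -, hsmul, hadd⟩ := h
  simpa [hsmul, abs_of_nonneg ha, abs_of_nonneg hb] using hadd (a • x) (b • y)

lemma continuous_s15 (h : IsNorm 𝒩) : Continuous 𝒩 := by
  have : ConvexOn ℝ univ 𝒩 :=
    ⟨convex_univ, fun x _ y _ a b ha hb _ => h.smul_add_smul_le ha hb x y⟩
  exact continuousOn_univ.1 (this.continuousOn isOpen_univ)

lemma exists_pos_mul_norm_le (h : IsNorm 𝒩) : ∃ c > 0, ∀ x, c * ‖x‖ ≤ 𝒩 x := by
  have hpos : ∀ x, x ≠ 0 → ‖x‖⁻¹ • x ∈ sphere (0 : EuclideanSpace ℝ (Fin N)) 1 := fun x hx => by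
    simp [norm_smul, hx]
  rcases (sphere (0 : EuclideanSpace ℝ (Fin N)) 1).eq_empty_or_nonempty with hs | hs
  · refine ⟨1, one_pos, fun x => ?_⟩
    rcases eq_or_ne x 0 with rfl | hx
    · simpa using h.1 0
    · simpa [hs] using hpos x hx
  · obtain ⟨z, hz, hmin⟩ := (isCompact_sphere _ _).exists_isMinOn hs h.continuous_s15.continuousOn
    have hz0 : z ≠ 0 := by
      rintro rfl
      simp at hz
    refine ⟨𝒩 z, lt_of_le_of_ne (h.1 z) fun h0 => hz0 ((h.2.1 z).1 h0.symm), fun x => ?_⟩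
    rcases eq_or_ne x 0 with rfl | hx
    · simpa using h.1 0
    · have h1 : 𝒩 z ≤ 𝒩 (‖x‖⁻¹ • x) := hmin (hpos x hx)
      rw [h.2.2.1, abs_of_nonneg (by positivity), inv_mul_eq_div,
        le_div_iff₀ (norm_pos_iff.2 hx)] at h1
      exact h1

lemma continuous_kernel (h : IsNorm 𝒩) {σ s p : ℝ} (hs : 0 < s) (hp : 0 ≤ p) :
    Continuous fun x => σ / (s + 𝒩 x ^ p) := by
  refine continuous_const.div
    (continuous_const.add (h.continuous_s15.rpow_const fun _ => .inr hp)) fun x => ?_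
  have := Real.rpow_nonneg (h.1 x) p
  positivity

lemma integrable_kernel (h : IsNorm 𝒩) {σ s p : ℝ} (hσ : 0 < σ) (hs : 0 < s) (hp : N < p) :
    Integrable fun x => σ / (s + 𝒩 x ^ p) := by
  obtain ⟨c, hc, hle⟩ := h.exists_pos_mul_norm_le
  have hp0 : 0 < p := (Nat.cast_nonneg N).trans_lt hp
  set m := min s (c ^ p) with hm
  have hm0 : 0 < m := lt_min hs (by positivity)
  have hint : Integrable fun x : EuclideanSpace ℝ (Fin N) => (1 + ‖x‖) ^ (-p) :=
    integrable_one_add_norm (by simpa using hp)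
  refine (hint.const_mul (σ * 2 ^ p / m)).mono'
    (h.continuous_kernel hs hp0.le).aestronglyMeasurable (Eventually.of_forall fun x => ?_)
  have hN := Real.rpow_nonneg (h.1 x) p
  have hx := norm_nonneg x
  have h1 : (1 + ‖x‖) ^ p ≤ 2 ^ p * (1 + ‖x‖ ^ p) := by
    have hxp : 0 ≤ ‖x‖ ^ p := by positivity
    have hmax : (max 1 ‖x‖) ^ p ≤ 1 + ‖x‖ ^ p := by
      rcases max_choice 1 ‖x‖ with h | h <;> rw [h]
      · simpa using hxp
      · linarith
    calc (1 + ‖x‖) ^ p ≤ (2 * max 1 ‖x‖) ^ p := by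
          gcongr
          linarith [le_max_left 1 ‖x‖, le_max_right 1 ‖x‖]
      _ = 2 ^ p * (max 1 ‖x‖) ^ p := Real.mul_rpow (by norm_num) (by positivity)
      _ ≤ _ := by gcongr
  have h2 : m * (1 + ‖x‖ ^ p) ≤ s + 𝒩 x ^ p := by
    calc m * (1 + ‖x‖ ^ p) = m + m * ‖x‖ ^ p := by ring
      _ ≤ s + c ^ p * ‖x‖ ^ p := by
          gcongr
          · exact min_le_left _ _
          · exact min_le_right _ _
      _ = s + (c * ‖x‖) ^ p := by rw [Real.mul_rpow hc.le hx]
      _ ≤ _ := by gcongr; exact hle x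
  rw [Real.norm_of_nonneg (by positivity), Real.rpow_neg (by positivity), ← div_eq_mul_inv,
    div_div, div_le_div_iff₀ (by positivity) (by positivity)]
  calc σ * (m * (1 + ‖x‖) ^ p) ≤ σ * (m * (2 ^ p * (1 + ‖x‖ ^ p))) := by gcongr
    _ = σ * 2 ^ p * (m * (1 + ‖x‖ ^ p)) := by ring
    _ ≤ σ * 2 ^ p * (s + 𝒩 x ^ p) := by gcongr

/-- The convolution of the kernel with the indicator of an open convex set is quasiconcave. -/
lemma min_integral_kernel_le (h : IsNorm 𝒩) {σ s p : ℝ} (hσ : 0 < σ) (hs : 0 < s) (hp1 : 1 ≤ p)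
    (hp : N < p) {A : Set (EuclideanSpace ℝ (Fin N))} (hAo : IsOpen A) (hA : Convex ℝ A)
    {a b : ℝ} (ha : 0 < a) (hb : 0 < b) (hab : a + b = 1) (x₀ x₁ : EuclideanSpace ℝ (Fin N)) :
    min (∫ y, A.indicator (fun y => σ / (s + 𝒩 (x₀ - y) ^ p)) y)
        (∫ y, A.indicator (fun y => σ / (s + 𝒩 (x₁ - y) ^ p)) y) ≤
      ∫ y, A.indicator (fun y => σ / (s + 𝒩 (a • x₀ + b • x₁ - y) ^ p)) y := by
  have hp0 : 0 < p := by linarith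
  have hpos : ∀ x, 0 < σ / (s + 𝒩 x ^ p) := fun x => by
    have := Real.rpow_nonneg (h.1 x) p
    positivity
  have hnn : ∀ x y, 0 ≤ A.indicator (fun y => σ / (s + 𝒩 (x - y) ^ p)) y := fun x y =>
    indicator_nonneg (fun y _ => (hpos _).le) y
  have hmeas : ∀ x, Measurable fun y =>
      ENNReal.ofReal (A.indicator (fun y => σ / (s + 𝒩 (x - y) ^ p)) y) := fun x =>
    (((h.continuous_kernel hs hp0.le).comp
      (continuous_const.sub continuous_id)).measurable.indicator hAo.measurableSet).ennreal_ofReal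
  have hint : ∀ x, Integrable (A.indicator fun y => σ / (s + 𝒩 (x - y) ^ p)) := fun x =>
    ((h.integrable_kernel hσ hs hp).comp_sub_left x).indicator hAo.measurableSet
  have hof : ∀ x, ENNReal.ofReal (∫ y, A.indicator (fun y => σ / (s + 𝒩 (x - y) ^ p)) y) =
      ∫⁻ y, ENNReal.ofReal (A.indicator (fun y => σ / (s + 𝒩 (x - y) ^ p)) y) := fun x =>
    ofReal_integral_eq_lintegral_ofReal (hint x) (Eventually.of_forall (hnn x))
  rw [← ENNReal.ofReal_le_ofReal_iff (integral_nonneg (hnn _)), ENNReal.ofReal_min, hof, hof, hof]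
  refine min_lintegral_le ha hb hab hp (hmeas _) (hmeas _) (hmeas _) fun y₀ y₁ => ?_
  by_cases h0 : y₀ ∈ A
  · by_cases h1 : y₁ ∈ A
    · rw [indicator_of_mem h0, indicator_of_mem h1,
        indicator_of_mem (hA h0 h1 ha.le hb.le hab), negPowerMean_ofReal ha hb (hpos _) (hpos _)]
      refine ENNReal.ofReal_le_ofReal
        (kernel_profile_concave ha hb hab hp1 hs hσ (h.1 _) (h.1 _) (h.1 _) ?_)
      convert h.smul_add_smul_le ha.le hb.le (x₀ - y₀) (x₁ - y₁) using 2
      module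
    · rw [indicator_of_notMem h1, ENNReal.ofReal_zero, negPowerMean_zero_right hb hp0]
      exact zero_le
  · rw [indicator_of_notMem h0, ENNReal.ofReal_zero, negPowerMean_zero_left ha hp0]
    exact zero_le

lemma convex_setOf_lt_integral_kernel (h : IsNorm 𝒩) {σ s p : ℝ} (hσ : 0 < σ) (hs : 0 < s)
    (hp1 : 1 ≤ p) (hp : N < p) {A : Set (EuclideanSpace ℝ (Fin N))} (hAo : IsOpen A)
    (hA : Convex ℝ A) {u : EuclideanSpace ℝ (Fin N) → ℝ}
    (hu : ∀ᵐ y, u y = if y ∈ A then 1 else -1) (c : ℝ) :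
    Convex ℝ {x | c < ∫ y, σ / (s + 𝒩 (x - y) ^ p) * u y} := by
  have hK := h.integrable_kernel hσ hs hp
  have hval : ∀ x, ∫ y, σ / (s + 𝒩 (x - y) ^ p) * u y =
      2 * (∫ y, A.indicator (fun y => σ / (s + 𝒩 (x - y) ^ p)) y) -
        ∫ y, σ / (s + 𝒩 y ^ p) := by
    intro x
    have hKx : Integrable fun y => σ / (s + 𝒩 (x - y) ^ p) := hK.comp_sub_left x
    rw [← integral_sub_left_eq_self (fun y => σ / (s + 𝒩 y ^ p)) volume x, ← integral_const_mul,
      ← integral_sub ((hKx.indicator hAo.measurableSet).const_mul 2) hKx]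
    refine integral_congr_ae ?_
    filter_upwards [hu] with y hy
    by_cases hyA : y ∈ A
    · simp [hy, hyA]
      ring
    · simp [hy, hyA]
  rw [convex_iff_forall_pos]
  intro x hx y hy a b ha hb hab
  simp only [mem_ofPred_eq, hval] at hx hy ⊢
  have := h.min_integral_kernel_le hσ hs hp1 hp hAo hA ha hb hab x y
  rcases min_le_iff.1 this with hle | hle <;> linarith

end IsNorm

lemma Convex.ae_notMem_frontier {N : ℕ} {A : Set (EuclideanSpace ℝ (Fin N))} (hA : Convex ℝ A) :
    ∀ᵐ y, y ∉ frontier A :=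
  measure_eq_zero_iff_ae_notMem.1 (hA.addHaar_frontier volume)

/-- Convexity preservation for the discrete threshold dynamics: starting from an open
convex set `Ω₀` with `u 0 = 1_{Ω₀} − 1_{(closure Ω₀)ᶜ}`, every set
`Ω (n+1) = {x | (J_h * u n)(x) > −g(nh) β(α,h)}` (with `u (n+1) = 1_{Ω (n+1)} − 1_{Ω (n+1)ᶜ}`)
is convex.  The scales `σ = σ_α(h)` and `β = β(α,h)` are `h^{α/2}` and `h^{1/2}` for
`α ∈ (1,2)`, and defined implicitly by `h = σ²|ln σ|`, `β = σ|ln σ|` for `α = 1`. -/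
theorem stmt_15 (N : ℕ) (hN : 2 ≤ N) (𝒩 : EuclideanSpace ℝ (Fin N) → ℝ) (h𝒩 : IsNorm 𝒩)
    (α : ℝ) (hα1 : 1 ≤ α) (hα2 : α < 2)
    (g : ℝ → ℝ) (hg : ContinuousOn g (Ici 0)) (h : ℝ) (hh : 0 < h)
    (Ω₀ : Set (EuclideanSpace ℝ (Fin N))) (hΩ₀open : IsOpen Ω₀) (hΩ₀conv : Convex ℝ Ω₀)
    (σ β : ℝ) (hσ : 0 < σ)
    (hrel : (α = 1 ∧ σ < 1 ∧ h = σ ^ 2 * |Real.log σ| ∧ β = σ * |Real.log σ|) ∨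
      (1 < α ∧ σ = h ^ (α/2) ∧ β = h ^ ((1:ℝ)/2)))
    (u : ℕ → EuclideanSpace ℝ (Fin N) → ℝ) (Ω : ℕ → Set (EuclideanSpace ℝ (Fin N)))
    (hu0 : ∀ x, u 0 x =
      (if x ∈ Ω₀ then (1:ℝ) else 0) - (if x ∈ (closure Ω₀)ᶜ then (1:ℝ) else 0))
    (hΩ : ∀ n : ℕ, Ω (n+1) = {x : EuclideanSpace ℝ (Fin N) |
      -(g ((n:ℝ) * h) * β) <
        ∫ y, (σ / (σ ^ (((N:ℝ) + α)/α) + 𝒩 (x - y) ^ ((N:ℝ) + α))) * u n y})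
    (hu : ∀ (n : ℕ) x, u (n+1) x = if x ∈ Ω (n+1) then (1:ℝ) else -1) :
    ∀ n : ℕ, Convex ℝ (Ω (n+1)) := by
  have hNα : (N : ℝ) < N + α := by linarith
  have hp1 : 1 ≤ (N : ℝ) + α := by linarith [(Nat.cast_nonneg N : (0 : ℝ) ≤ N)]
  have hs : 0 < σ ^ (((N : ℝ) + α) / α) := Real.rpow_pos_of_pos hσ _
  intro n
  induction n with
  | zero =>
    rw [hΩ 0]
    refine h𝒩.convex_setOf_lt_integral_kernel hσ hs hp1 hNα hΩ₀open hΩ₀conv ?_ _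
    filter_upwards [hΩ₀conv.ae_notMem_frontier] with y hy
    rw [hΩ₀open.frontier_eq] at hy
    by_cases hyA : y ∈ Ω₀
    · simp [hu0, hyA, subset_closure hyA]
    · have hyc : y ∉ closure Ω₀ := fun hyc => hy ⟨hyc, hyA⟩
      simp [hu0, hyA, hyc]
  | succ n ih =>
    rw [hΩ (n + 1)]
    refine h𝒩.convex_setOf_lt_integral_kernel hσ hs hp1 hNα isOpen_interior ih.interior ?_ _
    filter_upwards [ih.ae_notMem_frontier] with y hy
    have hiff : y ∈ Ω (n + 1) ↔ y ∈ interior (Ω (n + 1)) := by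
      refine ⟨fun hyA => ?_, fun hyA => interior_subset hyA⟩
      by_contra hyi
      exact hy ⟨subset_closure hyA, hyi⟩
    simp only [hu, hiff]
end
end
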